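/- arXiv:1302.1684 — 8 statements merged into one kernel-verified Lean document; each statement's English description precedes it below -/
import Mathlib

section
/- For every integer d ≥ 1 there exists N such that for all integers n ≥ N, the number a_d(n) of acyclic d-tournaments on vertex set [n] satisfies a_d(n) ≤ ((e/(d+1))·n)^{binom(n,d)}. -/
open Finset

/-- The induced-orientation sign `(τ;σ)`: if `τ ⊆ σ` and `|τ| + 1 = |σ|`, with
`σ = {i₀ < … < i_d}` and `τ = σ \ {i_j}`, this is `(-1)^(d - j)`; otherwise `0`. -/
def relSign (τ σ : Finset ℕ) : ℤ :=
  if τ ⊆ σ ∧ τ.card + 1 = σ.card then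
    ∑ x ∈ σ \ τ, (-1 : ℤ) ^ (σ.card - 1 - (σ.filter (fun y => y < x)).card)
  else 0

/-- A `d`-tournament on vertex set `V`: a sign `±1` for each `(d+1)`-element subset of `V`
(encoded as a function on all finsets, vanishing elsewhere).  The column of the incidence
matrix indexed by a face `F` is the function `fun τ => ε F * relSign τ F`. -/
def IsTournament (V : Finset ℕ) (d : ℕ) (ε : Finset ℕ → ℤ) : Prop :=
  ∀ σ : Finset ℕ,
    (σ ⊆ V ∧ σ.card = d + 1 → ε σ = 1 ∨ ε σ = -1) ∧
    (¬(σ ⊆ V ∧ σ.card = d + 1) → ε σ = 0)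

/-- `C` is a cycle: a nonempty set of `(d+1)`-element subsets of `V` admitting positive
real coefficients whose weighted incidence-matrix column sum vanishes. -/
def IsCycle (V : Finset ℕ) (d : ℕ) (ε : Finset ℕ → ℤ) (C : Finset (Finset ℕ)) : Prop :=
  C.Nonempty ∧ (∀ F ∈ C, F ⊆ V ∧ F.card = d + 1) ∧
    ∃ v : Finset ℕ → ℝ, (∀ F ∈ C, 0 < v F) ∧
      ∀ τ : Finset ℕ, ∑ F ∈ C, v F * ((ε F : ℝ) * (relSign τ F : ℝ)) = 0

def IsAcyclic (V : Finset ℕ) (d : ℕ) (ε : Finset ℕ → ℤ) : Prop :=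
  ∀ C : Finset (Finset ℕ), ¬ IsCycle V d ε C

/-- `a_d(n)`: the number of acyclic `d`-tournaments on vertex set `[n]`. -/
noncomputable def acyclicCount (d n : ℕ) : ℕ :=
  Nat.card {ε : Finset ℕ → ℤ //
    IsTournament (Finset.range n) d ε ∧ IsAcyclic (Finset.range n) d ε}

/-- Restriction (subtournament) of `ε` to the subsets of `S`. -/
def restrict (S : Finset ℕ) (ε : Finset ℕ → ℤ) : Finset ℕ → ℤ :=
  fun σ => if σ ⊆ S then ε σ else 0

/-- The link of the vertex `x`: it orients `τ` as the orientation induced on `τ`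
by `τ ∪ {x}`. -/
def link (ε : Finset ℕ → ℤ) (x : ℕ) : Finset ℕ → ℤ :=
  fun τ => ε (insert x τ) * relSign τ (insert x τ)

/-- The degree sequence `A · 1⃗`. -/
def degSeq (V : Finset ℕ) (d : ℕ) (ε : Finset ℕ → ℤ) : Finset ℕ → ℤ :=
  fun τ => ∑ F ∈ V.powersetCard (d + 1), ε F * relSign τ F

/-- A `0/1`-cycle: a nonempty set of faces whose incidence-matrix columns sum to zero. -/
def Is01Cycle (V : Finset ℕ) (d : ℕ) (ε : Finset ℕ → ℤ) (C : Finset (Finset ℕ)) : Prop :=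
  C.Nonempty ∧ (∀ F ∈ C, F ⊆ V ∧ F.card = d + 1) ∧
    ∀ τ : Finset ℕ, ∑ F ∈ C, ε F * relSign τ F = 0

/-- `U` is a `(d+2)`-cycle: the set of all its `(d+1)`-element subsets is a cycle. -/
def IsDCycle (V : Finset ℕ) (d : ℕ) (ε : Finset ℕ → ℤ) (U : Finset ℕ) : Prop :=
  U ⊆ V ∧ U.card = d + 2 ∧ IsCycle V d ε (U.powersetCard (d + 1))

/-- A `d`-element subset `τ` of `V` is free if all nonzero entries of its row
in the incidence matrix have the same sign. -/
def IsFree (V : Finset ℕ) (d : ℕ) (ε : Finset ℕ → ℤ) (τ : Finset ℕ) : Prop :=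
  τ ⊆ V ∧ τ.card = d ∧
    ((∀ σ ∈ V.powersetCard (d + 1), 0 ≤ ε σ * relSign τ σ) ∨
     (∀ σ ∈ V.powersetCard (d + 1), ε σ * relSign τ σ ≤ 0))

/-- An elementary collapse at a free `d`-face `τ`: all faces containing `τ` get sign `0`. -/
def CollapseStep (V : Finset ℕ) (d : ℕ) (ε ε' : Finset ℕ → ℤ) : Prop :=
  ∃ τ : Finset ℕ, IsFree V d ε τ ∧ ε' = fun σ => if τ ⊆ σ then 0 else ε σ

/-- Collapsibility: a finite sequence of elementary collapses reaching the zero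
partial tournament. -/
def Collapsible (V : Finset ℕ) (d : ℕ) (ε : Finset ℕ → ℤ) : Prop :=
  Relation.ReflTransGen (CollapseStep V d) ε (fun _ => 0)

/-- Realizability in `ℝ^d`: the orientations are induced by a general-position embedding
of the vertices, i.e. `ε σ` is the sign of the (nonzero) orientation determinant of the
points of `σ` listed in increasing order. -/
def Realizable (n d : ℕ) (ε : Finset ℕ → ℤ) : Prop :=
  ∃ ι : ℕ → Fin d → ℝ, ∀ σ : Finset ℕ, σ ⊆ Finset.range n → ∀ hσ : σ.card = d + 1,
    0 < (ε σ : ℝ) * Matrix.det (Matrix.of fun k l : Fin d =>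
      ι ((σ.orderIsoOfFin hσ) k.succ : ℕ) l - ι ((σ.orderIsoOfFin hσ) 0 : ℕ) l)

/-- Partial sums of binomial coefficients satisfy `∑_{i ≤ k} C(m, i) ≤ (e m / k) ^ k`. -/
theorem sum_range_choose_le_exp_mul_div_pow {m k : ℕ} (hk : 0 < k) (hkm : k ≤ m) :
    ((∑ i ∈ Finset.range (k + 1), m.choose i : ℕ) : ℝ) ≤
      (Real.exp 1 * ((m : ℝ) / k)) ^ k := by
  have hk' : (0 : ℝ) < k := by exact_mod_cast hk
  have hm' : (0 : ℝ) < m := by exact_mod_cast hk.trans_le hkm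
  set x : ℝ := (k : ℝ) / m with hx
  have hx0 : 0 < x := div_pos hk' hm'
  have hx1 : x ≤ 1 := (div_le_one hm').2 (by exact_mod_cast hkm)
  have key : x ^ k * ((∑ i ∈ Finset.range (k + 1), m.choose i : ℕ) : ℝ) ≤ Real.exp 1 ^ k := by
    calc x ^ k * ((∑ i ∈ Finset.range (k + 1), m.choose i : ℕ) : ℝ)
        = ∑ i ∈ Finset.range (k + 1), x ^ k * (m.choose i : ℝ) := by
          push_cast
          rw [Finset.mul_sum]
      _ ≤ ∑ i ∈ Finset.range (k + 1), x ^ i * (m.choose i : ℝ) := by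
          refine Finset.sum_le_sum fun i hi => mul_le_mul_of_nonneg_right ?_ (by positivity)
          exact pow_le_pow_of_le_one hx0.le hx1 (Nat.lt_succ_iff.1 (Finset.mem_range.1 hi))
      _ ≤ ∑ i ∈ Finset.range (m + 1), x ^ i * (m.choose i : ℝ) := by
          refine Finset.sum_le_sum_of_subset_of_nonneg ?_ fun i _ _ => by positivity
          exact Finset.range_mono (by omega)
      _ = (x + 1) ^ m := by simp [add_pow]
      _ ≤ Real.exp x ^ m := pow_le_pow_left₀ (by positivity) (Real.add_one_le_exp x) m
      _ = Real.exp 1 ^ k := by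
          rw [← Real.exp_nat_mul, ← Real.exp_nat_mul, hx, mul_one, mul_div_cancel₀ _ hm'.ne']
  have hinv : (m : ℝ) / k = x⁻¹ := by rw [hx, inv_div]
  rw [hinv, mul_pow, inv_pow, ← div_eq_mul_inv, le_div_iff₀ (by positivity), mul_comm]
  exact key

/-- Sauer–Shelah for a family of subsets of `P` all of whose shattered sets have size at
most `k`. -/
theorem card_le_sum_choose_of_shatters {α : Type*} [DecidableEq α] {𝒜 : Finset (Finset α)}
    {P : Finset α} {k : ℕ} (hP : ∀ s ∈ 𝒜, s ⊆ P)
    (hk : ∀ s, 𝒜.Shatters s → s.card ≤ k) :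
    𝒜.card ≤ ∑ i ∈ Finset.range (k + 1), P.card.choose i := by
  have hsub : 𝒜.shatterer ⊆ (Finset.range (k + 1)).biUnion fun i => P.powersetCard i := by
    intro s hs
    have hs := Finset.mem_shatterer.1 hs
    obtain ⟨t, ht, hst⟩ := hs.exists_superset
    simp only [Finset.mem_biUnion, Finset.mem_range, Finset.mem_powersetCard]
    exact ⟨s.card, Nat.lt_succ_iff.2 (hk s hs), hst.trans (hP t ht), rfl⟩
  calc 𝒜.card ≤ 𝒜.shatterer.card := Finset.card_le_card_shatterer 𝒜
    _ ≤ _ := Finset.card_le_card hsub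
    _ ≤ ∑ i ∈ Finset.range (k + 1), (P.powersetCard i).card := Finset.card_biUnion_le
    _ = _ := by simp

/-- The set of positively oriented faces. -/
def positiveFaces (V : Finset ℕ) (d : ℕ) (ε : Finset ℕ → ℤ) : Finset (Finset ℕ) :=
  {F ∈ V.powersetCard (d + 1) | ε F = 1}

theorem positiveFaces_injOn (V : Finset ℕ) (d : ℕ) :
    Set.InjOn (positiveFaces V d) {ε | IsTournament V d ε} := by
  intro ε hε ε' hε' h
  funext σ
  by_cases hσ : σ ⊆ V ∧ σ.card = d + 1
  · have hiff : ε σ = 1 ↔ ε' σ = 1 := by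
      simpa [positiveFaces, hσ] using congrArg (σ ∈ ·) h
    have h1 := (hε σ).1 hσ
    have h2 := (hε' σ).1 hσ
    omega
  · rw [(hε σ).2 hσ, (hε' σ).2 hσ]

/-- If `ε` orients the faces of `S` according to the signs of the coefficients of a nontrivial
linear relation among the unsigned boundary columns, then `ε` has a cycle. -/
theorem not_isAcyclic_of_relation {V : Finset ℕ} {d : ℕ} {ε : Finset ℕ → ℤ}
    {S : Finset (Finset ℕ)} (hS : S ⊆ V.powersetCard (d + 1)) {c : Finset ℕ → ℝ}
    (hc : ∃ F ∈ S, c F ≠ 0)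
    (hrel : ∀ τ ∈ V.powersetCard d, ∑ F ∈ S, c F * (relSign τ F : ℝ) = 0)
    (hpos : ∀ F ∈ S, 0 < c F → ε F = 1) (hneg : ∀ F ∈ S, c F < 0 → ε F = -1) :
    ¬ IsAcyclic V d ε := by
  intro hac
  refine hac {F ∈ S | c F ≠ 0} ⟨?_, ?_, fun F => |c F|, ?_, ?_⟩
  · obtain ⟨F, hF, hcF⟩ := hc
    exact ⟨F, by simp [hF, hcF]⟩
  · intro F hF
    exact Finset.mem_powersetCard.1 (hS (Finset.mem_filter.1 hF).1)
  · intro F hF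
    exact abs_pos.2 (Finset.mem_filter.1 hF).2
  · intro τ
    have hterm : ∀ F ∈ S, |c F| * ((ε F : ℝ) * (relSign τ F : ℝ)) = c F * (relSign τ F : ℝ) := by
      intro F hF
      rcases lt_trichotomy (c F) 0 with h | h | h
      · rw [hneg F hF h, abs_of_neg h]
        push_cast
        ring
      · simp [h]
      · rw [hpos F hF h, abs_of_pos h]
        push_cast
        ring
    rw [Finset.sum_filter_of_ne fun F _ h => abs_ne_zero.1 (left_ne_zero_of_mul h),
      Finset.sum_congr rfl hterm]
    by_cases hτ : τ ∈ V.powersetCard d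
    · exact hrel τ hτ
    · refine Finset.sum_eq_zero fun F hF => ?_
      obtain ⟨hFV, hFc⟩ := Finset.mem_powersetCard.1 (hS hF)
      have h0 : relSign τ F = 0 := if_neg fun ⟨hsub, hcard⟩ =>
        hτ (Finset.mem_powersetCard.2 ⟨hsub.trans hFV, by omega⟩)
      simp [h0]

/-- More than `C(|V|, d)` faces admit a nontrivial linear relation between their boundaries. -/
theorem exists_relation_of_choose_lt_card {V : Finset ℕ} {d : ℕ} {S : Finset (Finset ℕ)}
    (h : V.card.choose d < S.card) :
    ∃ c : Finset ℕ → ℝ, (∃ F ∈ S, c F ≠ 0) ∧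
      ∀ τ ∈ V.powersetCard d, ∑ F ∈ S, c F * (relSign τ F : ℝ) = 0 := by
  have hdep : ¬ LinearIndepOn ℝ
      (fun (F : Finset ℕ) (τ : V.powersetCard d) => (relSign τ F : ℝ)) (S : Set (Finset ℕ)) := by
    intro hli
    have := LinearIndependent.fintype_card_le_finrank hli
    simp at this
    omega
  rw [linearIndepOn_finset_iff] at hdep
  push Not at hdep
  obtain ⟨c, hsum, hne⟩ := hdep
  refine ⟨c, hne, fun τ hτ => ?_⟩
  simpa using congrFun hsum ⟨τ, hτ⟩

theorem card_le_of_shatters_positiveFaces {V : Finset ℕ} {d : ℕ}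
    {𝒜 : Finset (Finset (Finset ℕ))}
    (h𝒜 : ∀ s ∈ 𝒜, ∃ ε, IsTournament V d ε ∧ IsAcyclic V d ε ∧ positiveFaces V d ε = s)
    {S : Finset (Finset ℕ)} (hS : 𝒜.Shatters S) : S.card ≤ V.card.choose d := by
  by_contra! hlt
  have hSP : S ⊆ V.powersetCard (d + 1) := by
    obtain ⟨t, ht, hSt⟩ := hS.exists_superset
    obtain ⟨ε, -, -, rfl⟩ := h𝒜 t ht
    exact hSt.trans (Finset.filter_subset _ _)
  obtain ⟨c, hc, hrel⟩ := exists_relation_of_choose_lt_card hlt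
  obtain ⟨t, ht, hSt⟩ := hS (Finset.filter_subset (fun F => 0 < c F) S)
  obtain ⟨ε, hT, hA, rfl⟩ := h𝒜 t ht
  have hmem : ∀ F ∈ S, (ε F = 1 ↔ 0 < c F) := by
    intro F hF
    have := congrArg (F ∈ ·) hSt
    simpa [positiveFaces, hF, Finset.mem_powersetCard.1 (hSP hF)] using this
  refine not_isAcyclic_of_relation hSP hc hrel (fun F hF h => (hmem F hF).2 h) ?_ hA
  intro F hF h
  refine ((hT F).1 (Finset.mem_powersetCard.1 (hSP hF))).resolve_left fun h1 => ?_
  exact h.not_gt ((hmem F hF).1 h1)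

/-- The number of acyclic `d`-tournaments is at most `∑_{i ≤ C(n, d)} C(C(n, d + 1), i)`. -/
theorem acyclicCount_le_sum_choose (d n : ℕ) :
    acyclicCount d n ≤ ∑ i ∈ Finset.range (n.choose d + 1), (n.choose (d + 1)).choose i := by
  classical
  set V := Finset.range n
  let T : Set (Finset ℕ → ℤ) := {ε | IsTournament V d ε ∧ IsAcyclic V d ε}
  let 𝒜 : Finset (Finset (Finset ℕ)) :=
    {s ∈ (V.powersetCard (d + 1)).powerset | s ∈ positiveFaces V d '' T}
  have h𝒜 : (𝒜 : Set (Finset (Finset ℕ))) = positiveFaces V d '' T := by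
    ext s
    simp only [𝒜, Finset.coe_filter, Set.mem_ofPred_eq, Finset.mem_powerset,
      and_iff_right_iff_imp]
    rintro ⟨ε, -, rfl⟩
    exact Finset.filter_subset _ _
  have hcard : acyclicCount d n = 𝒜.card := by
    have hinj : Set.InjOn (positiveFaces V d) T :=
      (positiveFaces_injOn V d).mono fun ε hε => hε.1
    rw [← Set.ncard_coe_finset, h𝒜, Set.InjOn.ncard_image hinj]
    rfl
  rw [hcard]
  have hbound := card_le_sum_choose_of_shatters (𝒜 := 𝒜) (P := V.powersetCard (d + 1))
    (k := V.card.choose d)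
    (fun s hs => Finset.mem_powerset.1 (Finset.mem_filter.1 hs).1)
    (fun S hS => card_le_of_shatters_positiveFaces (fun s hs => by
      obtain ⟨ε, hε, rfl⟩ := (Finset.mem_filter.1 hs).2
      exact ⟨ε, hε.1, hε.2, rfl⟩) hS)
  simpa [V] using hbound

/-- for every `d ≥ 1` and all large enough `n`,
`a_d(n) ≤ ((e/(d+1))·n)^{C(n,d)}`. -/
theorem acyclicCount_upper_bound (d : ℕ) (hd : 1 ≤ d) :
    ∃ N : ℕ, ∀ n : ℕ, N ≤ n →
      (acyclicCount d n : ℝ) ≤ (Real.exp 1 / ((d : ℝ) + 1) * (n : ℝ)) ^ n.choose d := by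
  refine ⟨2 * d + 1, fun n hn => ?_⟩
  have hD : 0 < n.choose d := Nat.choose_pos (by omega)
  have hmul : n.choose (d + 1) * (d + 1) = n.choose d * (n - d) := Nat.choose_succ_right_eq n d
  have hDM : n.choose d ≤ n.choose (d + 1) := by
    refine Nat.le_of_mul_le_mul_right ?_ (Nat.succ_pos d)
    rw [Nat.succ_eq_add_one, hmul]
    exact Nat.mul_le_mul_left _ (by omega)
  have hratio : (n.choose (d + 1) : ℝ) / n.choose d ≤ n / ((d : ℝ) + 1) := by
    rw [div_le_div_iff₀ (by exact_mod_cast hD) (by positivity)]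
    have hle : n.choose (d + 1) * (d + 1) ≤ n * n.choose d := by
      rw [hmul, mul_comm]
      exact Nat.mul_le_mul_right _ (Nat.sub_le n d)
    exact_mod_cast hle
  calc (acyclicCount d n : ℝ)
      ≤ ((∑ i ∈ Finset.range (n.choose d + 1), (n.choose (d + 1)).choose i : ℕ) : ℝ) := by
        exact_mod_cast acyclicCount_le_sum_choose d n
    _ ≤ (Real.exp 1 * ((n.choose (d + 1) : ℝ) / n.choose d)) ^ n.choose d :=
        sum_range_choose_le_exp_mul_div_pow hD hDM
    _ ≤ (Real.exp 1 * (n / ((d : ℝ) + 1))) ^ n.choose d := by gcongr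
    _ = (Real.exp 1 / ((d : ℝ) + 1) * (n : ℝ)) ^ n.choose d := by
        congr 1
        ring
end

section
/- For every integer d ≥ 1 and every real ε > 0 there exists N such that for all integers n ≥ N, the number a_d(n) of acyclic d-tournaments on vertex set [n] satisfies a_d(n) ≥ (n/(e^{H_d}+ε))^{binom(n,d)}, where H_d = Σ_{k=1}^{d} 1/k is the d-th harmonic number. -/
open Finset

lemma relSign_eq_zero_of_not_subset {τ σ : Finset ℕ} (h : ¬τ ⊆ σ) : relSign τ σ = 0 :=
  if_neg fun h' => h h'.1

/-- Coning with a vertex above all others flips the induced-orientation sign. -/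
lemma relSign_insert {n : ℕ} {τ σ : Finset ℕ} (hτ : n ∉ τ) (hσ : σ ⊆ range n) :
    relSign (insert n τ) (insert n σ) = -relSign τ σ := by
  have hnσ : n ∉ σ := fun h => by simpa using hσ h
  unfold relSign
  have h_sub : insert n τ ⊆ insert n σ ↔ τ ⊆ σ := by
    constructor
    · intro h x hx
      rcases mem_insert.1 (h (mem_insert_of_mem hx)) with rfl | h'
      · exact absurd hx hτ
      · exact h'
    · exact insert_subset_insert n
  have h_sdiff : insert n σ \ insert n τ = σ \ τ := by
    ext x
    simp only [mem_sdiff, mem_insert, not_or]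
    constructor
    · rintro ⟨rfl | h, h1, h2⟩
      · exact absurd rfl h1
      · exact ⟨h, h2⟩
    · rintro ⟨h, h2⟩
      exact ⟨Or.inr h, fun hx => hnσ (hx ▸ h), h2⟩
  simp only [h_sub, h_sdiff, card_insert_of_notMem hτ, card_insert_of_notMem hnσ,
    Nat.add_right_cancel_iff]
  split_ifs with h
  · rw [← Finset.sum_neg_distrib]
    refine sum_congr rfl fun x hx => ?_
    have hxσ : x ∈ σ := (mem_sdiff.1 hx).1
    have hxn : x < n := mem_range.1 (hσ hxσ)
    have h_filter : (insert n σ).filter (fun y => y < x) = σ.filter (fun y => y < x) := by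
      rw [filter_insert, if_neg (by omega)]
    have h_lt : (σ.filter (fun y => y < x)).card < σ.card :=
      card_lt_card (filter_ssubset.2 ⟨x, hxσ, lt_irrefl x⟩)
    rw [h_filter, show σ.card + 1 - 1 - (σ.filter (fun y => y < x)).card =
      (σ.card - 1 - (σ.filter (fun y => y < x)).card) + 1 by omega, pow_succ]
    ring
  · simp

lemma relSign_singleton_left {i j : ℕ} (h : i < j) : relSign {i} {i, j} = 1 := by
  have h_sdiff : ({i, j} : Finset ℕ) \ {i} = {j} := by
    ext x; simp only [mem_sdiff, mem_insert, mem_singleton]; omega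
  have h_filter : ({i, j} : Finset ℕ).filter (fun y => y < j) = {i} := by
    ext x; simp only [mem_filter, mem_insert, mem_singleton]; omega
  simp [relSign, h_sdiff, h_filter, card_pair h.ne]

lemma relSign_singleton_right {i j : ℕ} (h : i < j) : relSign {j} {i, j} = -1 := by
  have h_sdiff : ({i, j} : Finset ℕ) \ {j} = {i} := by
    ext x; simp only [mem_sdiff, mem_insert, mem_singleton]; omega
  have h_filter : ({i, j} : Finset ℕ).filter (fun y => y < i) = ∅ := by
    rw [filter_eq_empty_iff]
    intro x
    simp only [mem_insert, mem_singleton]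
    omega
  simp [relSign, h_sdiff, h_filter, card_pair h.ne]

lemma finite_tournaments (V : Finset ℕ) (d : ℕ) : {ε | IsTournament V d ε}.Finite := by
  refine Set.Finite.of_injOn (f := fun ε (σ : V.powerset) => ε σ)
    (t := Set.univ.pi fun _ => Set.Icc (-1) 1) ?_ ?_
    (Set.Finite.pi fun _ => Set.finite_Icc _ _)
  · intro ε hε σ _
    by_cases h : (σ : Finset ℕ) ⊆ V ∧ (σ : Finset ℕ).card = d + 1
    · rcases (hε σ).1 h with h | h <;> simp [h]
    · simp [(hε σ).2 h]
  · intro ε hε ε' hε' h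
    funext σ
    by_cases hσ : σ ⊆ V
    · exact congrFun h ⟨σ, mem_powerset.2 hσ⟩
    · rw [(hε σ).2 fun h => hσ h.1, (hε' σ).2 fun h => hσ h.1]

instance finite_acyclic (V : Finset ℕ) (d : ℕ) :
    Finite {ε : Finset ℕ → ℤ // IsTournament V d ε ∧ IsAcyclic V d ε} :=
  ((finite_tournaments V d).subset fun _ h => h.1).to_subtype

/-- The tournament on `range (n + 1)` that restricts to `T` on `range n` and whose faces
through `n` are signed by `L`. -/
def coneTournament (n : ℕ) (T L : Finset ℕ → ℤ) : Finset ℕ → ℤ :=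
  fun σ => if n ∈ σ then L (σ.erase n) else T σ

lemma subset_range_of_subset_range_succ {n : ℕ} {σ : Finset ℕ} (h : σ ⊆ range (n + 1))
    (hn : n ∉ σ) : σ ⊆ range n := fun x hx => by
  have h1 := mem_range.1 (h hx)
  have h2 : x ≠ n := fun h => hn (h ▸ hx)
  exact mem_range.2 (by omega)

lemma erase_subset_range_iff {n : ℕ} {σ : Finset ℕ} :
    σ.erase n ⊆ range n ↔ σ ⊆ range (n + 1) := by
  rw [range_add_one, ← subset_insert_iff]

lemma isTournament_coneTournament {n d : ℕ} {T L : Finset ℕ → ℤ}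
    (hT : IsTournament (range n) (d + 1) T) (hL : IsTournament (range n) d L) :
    IsTournament (range (n + 1)) (d + 1) (coneTournament n T L) := by
  intro σ
  by_cases hn : n ∈ σ
  · have hc := card_erase_add_one hn
    have h := hL (σ.erase n)
    have hiff : σ.card = d + 1 + 1 ↔ (σ.erase n).card = d + 1 := by omega
    simpa only [coneTournament, if_pos hn, hiff, ← erase_subset_range_iff] using h
  · have h := hT σ
    have hiff : σ ⊆ range (n + 1) ↔ σ ⊆ range n :=
      ⟨fun h => subset_range_of_subset_range_succ h hn,
        fun h => h.trans (range_subset_range.2 n.le_succ)⟩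
    simpa only [coneTournament, if_neg hn, hiff] using h

lemma isAcyclic_coneTournament {n d : ℕ} {T L : Finset ℕ → ℤ}
    (hT : IsAcyclic (range n) (d + 1) T) (hL : IsAcyclic (range n) d L) :
    IsAcyclic (range (n + 1)) (d + 1) (coneTournament n T L) := by
  rintro C ⟨hne, hC, v, hv, hsum⟩
  by_cases hn : ∃ F ∈ C, n ∈ F
  · obtain ⟨F₀, hF₀, hnF₀⟩ := hn
    have h_inj : Set.InjOn (fun F : Finset ℕ => F.erase n) (C.filter (n ∈ ·)) := by
      intro F hF G hG h
      have hF' := (mem_filter.1 hF).2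
      have hG' := (mem_filter.1 hG).2
      rw [← insert_erase hF', ← insert_erase hG']
      exact congrArg (insert n) h
    refine hL ((C.filter (n ∈ ·)).image fun F => F.erase n) ⟨?_, ?_, fun F => v (insert n F), ?_, ?_⟩
    · exact ⟨F₀.erase n, mem_image_of_mem _ (mem_filter.2 ⟨hF₀, hnF₀⟩)⟩
    · intro G hG
      obtain ⟨F, hF, rfl⟩ := mem_image.1 hG
      obtain ⟨hFC, hnF⟩ := mem_filter.1 hF
      have hc := card_erase_add_one hnF
      have := (hC F hFC).2
      exact ⟨erase_subset_range_iff.2 (hC F hFC).1, by omega⟩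
    · intro G hG
      obtain ⟨F, hF, rfl⟩ := mem_image.1 hG
      obtain ⟨hFC, hnF⟩ := mem_filter.1 hF
      simpa only [insert_erase hnF] using hv F hFC
    · intro τ
      rw [sum_image h_inj]
      by_cases hτ : n ∈ τ
      · refine sum_eq_zero fun F _ => ?_
        rw [relSign_eq_zero_of_not_subset fun h => notMem_erase n F (h hτ)]
        simp
      · rw [← neg_eq_zero, ← hsum (insert n τ), ← sum_neg_distrib, sum_filter]
        refine sum_congr rfl fun F hF => ?_
        split_ifs with hnF
        · have h := relSign_insert hτ (erase_subset_range_iff.2 (hC F hF).1)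
          rw [insert_erase hnF] at h
          simp only [insert_erase hnF, coneTournament, if_pos hnF, h]
          push_cast
          ring
        · rw [relSign_eq_zero_of_not_subset fun h => hnF (h (mem_insert_self n τ))]
          simp
  · push Not at hn
    refine hT C ⟨hne, fun F hF => ⟨subset_range_of_subset_range_succ (hC F hF).1 (hn F hF),
      (hC F hF).2⟩, v, hv, fun τ => ?_⟩
    rw [← hsum τ]
    exact sum_congr rfl fun F hF => by simp only [coneTournament, if_neg (hn F hF)]

lemma acyclicCount_mul_le (d n : ℕ) :
    acyclicCount (d + 1) n * acyclicCount d n ≤ acyclicCount (d + 1) (n + 1) := by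
  unfold acyclicCount
  rw [← Nat.card_prod]
  refine Nat.card_le_card_of_injective (fun p => ⟨coneTournament n p.1.1 p.2.1,
    isTournament_coneTournament p.1.2.1 p.2.2.1, isAcyclic_coneTournament p.1.2.2 p.2.2.2⟩) ?_
  rintro ⟨⟨T, hT, _⟩, ⟨L, hL, _⟩⟩ ⟨⟨T', hT', _⟩, ⟨L', hL', _⟩⟩ h
  have h : coneTournament n T L = coneTournament n T' L' := congrArg Subtype.val h
  have hTT : T = T' := by
    funext σ
    by_cases hn : n ∈ σ
    · have hσ : ¬σ ⊆ range n := fun h => by simpa using h hn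
      rw [(hT σ).2 fun h => hσ h.1, (hT' σ).2 fun h => hσ h.1]
    · simpa [coneTournament, hn] using congrFun h σ
  have hLL : L = L' := by
    funext σ
    by_cases hn : n ∈ σ
    · have hσ : ¬σ ⊆ range n := fun h => by simpa using h hn
      rw [(hL σ).2 fun h => hσ h.1, (hL' σ).2 fun h => hσ h.1]
    · simpa [coneTournament, hn] using congrFun h (insert n σ)
  subst hTT hLL
  rfl

lemma acyclicCount_zero_right (d : ℕ) : 0 < acyclicCount d 0 := by
  have : Nonempty {ε : Finset ℕ → ℤ //
      IsTournament (range 0) d ε ∧ IsAcyclic (range 0) d ε} := by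
    have h_empty : ∀ σ : Finset ℕ, ¬(σ ⊆ range 0 ∧ σ.card = d + 1) := by
      rintro σ ⟨h, h'⟩
      have := card_le_card h
      simp only [card_range] at this
      omega
    refine ⟨fun _ => 0, fun σ => ⟨fun h => absurd h (h_empty σ), fun _ => rfl⟩, ?_⟩
    rintro C ⟨⟨F, hF⟩, hC, -⟩
    exact h_empty F (hC F hF)
  exact Nat.card_pos

/-- The `1`-tournament on `range n` orienting every edge along the potential `w`. -/
def potentialTournament (n : ℕ) (w : ℕ → ℤ) : Finset ℕ → ℤ :=
  fun F => if F ⊆ range n ∧ F.card = 2 then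
    (∑ x ∈ range n, w x * relSign {x} F).sign else 0

lemma sum_mul_relSign_pair {n i j : ℕ} (w : ℕ → ℤ) (hij : i < j) (hj : j < n) :
    ∑ x ∈ range n, w x * relSign {x} {i, j} = w i - w j := by
  have h_sub : ({i, j} : Finset ℕ) ⊆ range n := by
    intro x
    simp only [mem_insert, mem_singleton, mem_range]
    omega
  rw [← sum_subset h_sub, sum_pair hij.ne, relSign_singleton_left hij,
    relSign_singleton_right hij]
  · ring
  · intro x _ hx
    rw [relSign_eq_zero_of_not_subset (by simpa using hx), mul_zero]

lemma potentialTournament_pair {n i j : ℕ} (w : ℕ → ℤ) (hij : i < j) (hj : j < n) :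
    potentialTournament n w {i, j} = (w i - w j).sign := by
  have h_sub : ({i, j} : Finset ℕ) ⊆ range n := by
    intro x
    simp only [mem_insert, mem_singleton, mem_range]
    omega
  rw [potentialTournament, if_pos ⟨h_sub, card_pair hij.ne⟩, sum_mul_relSign_pair w hij hj]

lemma sum_mul_relSign_ne_zero {n : ℕ} {w : ℕ → ℤ} (hw : Set.InjOn w (range n))
    {F : Finset ℕ} (hF : F ⊆ range n) (hc : F.card = 2) :
    ∑ x ∈ range n, w x * relSign {x} F ≠ 0 := by
  obtain ⟨i, j, hij, rfl⟩ := card_eq_two.1 hc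
  wlog h : i < j generalizing i j
  · rw [pair_comm i j] at hF hc ⊢
    exact this j i hij.symm hF hc (by omega)
  have hi : i ∈ range n := hF (by simp)
  have hj : j ∈ range n := hF (by simp)
  rw [sum_mul_relSign_pair w h (mem_range.1 hj), sub_ne_zero]
  exact fun h' => hij (hw hi hj h')

lemma isTournament_potentialTournament {n : ℕ} {w : ℕ → ℤ} (hw : Set.InjOn w (range n)) :
    IsTournament (range n) 1 (potentialTournament n w) := by
  refine fun σ => ⟨fun h => ?_, fun h => if_neg h⟩
  rw [potentialTournament, if_pos h]
  rcases lt_or_gt_of_ne (sum_mul_relSign_ne_zero hw h.1 h.2) with h' | h'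
  · exact Or.inr (Int.sign_eq_neg_one_of_neg h')
  · exact Or.inl (Int.sign_eq_one_of_pos h')

lemma isAcyclic_potentialTournament {n : ℕ} {w : ℕ → ℤ} (hw : Set.InjOn w (range n)) :
    IsAcyclic (range n) 1 (potentialTournament n w) := by
  rintro C ⟨hne, hC, v, hv, hsum⟩
  have h_zero : ∑ F ∈ C, v F * ((potentialTournament n w F *
      ∑ x ∈ range n, w x * relSign {x} F : ℤ) : ℝ) = 0 := by
    calc _ = ∑ x ∈ range n, (w x : ℝ) * ∑ F ∈ C,
          v F * ((potentialTournament n w F : ℝ) * (relSign {x} F : ℝ)) := by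
          simp only [mul_sum]
          rw [sum_comm]
          refine sum_congr rfl fun F _ => ?_
          push_cast
          simp only [mul_sum]
          exact sum_congr rfl fun x _ => by ring
      _ = 0 := by simp [hsum]
  refine (sum_pos (fun F hF => mul_pos (hv F hF) ?_) hne).ne' h_zero
  have h := hC F hF
  rw [potentialTournament, if_pos h, Int.sign_mul_self_eq_abs]
  exact_mod_cast abs_pos.2 (sum_mul_relSign_ne_zero hw h.1 h.2)

lemma factorial_le_acyclicCount (n : ℕ) : n.factorial ≤ acyclicCount 1 n := by
  let w (π : Equiv.Perm (Fin n)) (x : ℕ) : ℤ := if h : x < n then (π ⟨x, h⟩ : ℕ) else 0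
  have h_val (π : Equiv.Perm (Fin n)) (i : Fin n) : w π i = (π i : ℕ) := dif_pos i.2
  have hw (π : Equiv.Perm (Fin n)) : Set.InjOn (w π) (range n) := by
    intro x hx y hy h
    have hx' : x < n := by simpa using hx
    have hy' : y < n := by simpa using hy
    have h' : (π ⟨x, hx'⟩ : ℕ) = π ⟨y, hy'⟩ := by
      simpa only [w, dif_pos hx', dif_pos hy', Nat.cast_inj] using h
    simpa using π.injective (Fin.ext h')
  have h_card : n.factorial = Nat.card (Equiv.Perm (Fin n)) := by
    rw [Nat.card_eq_fintype_card, Fintype.card_perm, Fintype.card_fin]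
  rw [h_card, acyclicCount]
  refine Nat.card_le_card_of_injective (fun π => ⟨potentialTournament n (w π),
    isTournament_potentialTournament (hw π), isAcyclic_potentialTournament (hw π)⟩) ?_
  intro π ρ h
  have h : potentialTournament n (w π) = potentialTournament n (w ρ) := congrArg Subtype.val h
  have h_sign (i j : Fin n) (hij : i < j) :
      ((π i : ℕ) - (π j : ℕ) : ℤ).sign = ((ρ i : ℕ) - (ρ j : ℕ) : ℤ).sign := by
    have := congrFun h {(i : ℕ), (j : ℕ)}
    rwa [potentialTournament_pair _ hij j.2, potentialTournament_pair _ hij j.2,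
      h_val, h_val, h_val, h_val] at this
  have h_lt (i j : Fin n) (hij : π i < π j) : ρ i < ρ j := by
    rcases lt_trichotomy i j with h' | h' | h'
    · have h1 := h_sign i j h'
      rw [Int.sign_eq_neg_one_of_neg (by omega)] at h1
      have := Int.sign_eq_neg_one_iff_neg.1 h1.symm
      omega
    · exact absurd hij (by simp [h'])
    · have h1 := h_sign j i h'
      rw [Int.sign_eq_one_of_pos (by omega)] at h1
      have := Int.sign_eq_one_iff_pos.1 h1.symm
      omega
  have h_mono : StrictMono (π.symm.trans ρ) := fun a b hab =>
    h_lt _ _ (by simpa using hab)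
  have h_id := Subsingleton.elim (h_mono.orderIsoOfSurjective _ (Equiv.surjective _))
    (OrderIso.refl (Fin n))
  ext i
  have := congrArg (fun f : Fin n ≃o Fin n => (f (π i) : ℕ)) h_id
  simpa using this.symm

lemma acyclicCount_pos (d n : ℕ) : 0 < acyclicCount (d + 1) n := by
  induction d generalizing n with
  | zero => exact n.factorial_pos.trans_le (factorial_le_acyclicCount n)
  | succ d ih =>
    induction n with
    | zero => exact acyclicCount_zero_right _
    | succ n ihn => exact (Nat.mul_pos ihn (ih n)).trans_le (acyclicCount_mul_le _ _)

lemma choose_mul_log_succ_sub_log_le (d n : ℕ) :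
    ((n + 1).choose (d + 2) : ℝ) * (Real.log ((n + 1 : ℕ) : ℝ) - Real.log n) ≤
      n.choose d + n.choose (d + 1) / (d + 2) := by
  rcases Nat.eq_zero_or_pos n with rfl | hn
  · simp [Nat.choose_eq_zero_of_lt (show 0 + 1 < d + 2 by omega)]
  have hn' : (0 : ℝ) < n := by exact_mod_cast hn
  have h_log : Real.log ((n + 1 : ℕ) : ℝ) - Real.log n ≤ 1 / n := by
    rw [← Real.log_div (by positivity) hn'.ne']
    refine (Real.log_le_sub_one_of_pos (by positivity)).trans_eq ?_
    push_cast
    field_simp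
    ring
  have h_top : ((n + 1).choose (d + 2) : ℝ) = (n + 1) * n.choose (d + 1) / (d + 2) := by
    rw [eq_div_iff (by positivity)]
    exact_mod_cast (Nat.add_one_mul_choose_eq n (d + 1)).symm
  have h_bot : (n.choose (d + 1) : ℝ) * (d + 1) ≤ n.choose d * n := by
    have := Nat.choose_succ_right_eq n d
    have h' : n.choose (d + 1) * (d + 1) ≤ n.choose d * n :=
      this.trans_le (Nat.mul_le_mul_left _ (Nat.sub_le n d))
    exact_mod_cast h'
  calc _ ≤ ((n + 1).choose (d + 2) : ℝ) * (1 / n) := by gcongr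
    _ = n.choose (d + 1) / n / (d + 2) + n.choose (d + 1) / (d + 2) := by
      rw [h_top]; field_simp; ring
    _ ≤ _ := by
      gcongr
      rw [div_div, div_le_iff₀ (by positivity)]
      have : (0 : ℝ) ≤ n.choose (d + 1) * d := by positivity
      have : (0 : ℝ) ≤ n.choose d * n := by positivity
      have : (0 : ℝ) ≤ n.choose d * n * d := by positivity
      have : (0 : ℝ) ≤ n.choose (d + 1) := by positivity
      nlinarith

lemma le_log_acyclicCount (d n : ℕ) :
    (n.choose (d + 1) : ℝ) * (Real.log n - ∑ k ∈ Icc 1 (d + 1), (1 : ℝ) / k) -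
      d * n.choose d ≤ Real.log (acyclicCount (d + 1) n) := by
  induction d generalizing n with
  | zero =>
    have h1 : Real.log n.factorial ≤ Real.log (acyclicCount 1 n) :=
      Real.log_le_log (by exact_mod_cast n.factorial_pos)
        (by exact_mod_cast factorial_le_acyclicCount n)
    refine le_trans ?_ h1
    rcases Nat.eq_zero_or_pos n with rfl | hn
    · simp
    have hn' : (0 : ℝ) < n := by exact_mod_cast hn
    have hf : (0 : ℝ) < n.factorial := by exact_mod_cast n.factorial_pos
    have h2 := Real.log_le_log (by positivity) (Real.pow_div_factorial_le_exp n hn'.le n)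
    rw [Real.log_exp, Real.log_div (by positivity) hf.ne', Real.log_pow] at h2
    simp
    linarith
  | succ d ih =>
    induction n with
    | zero => simpa [Nat.choose_eq_zero_of_lt] using Real.log_natCast_nonneg _
    | succ n ihn =>
      have h_pos₁ : (0 : ℝ) < acyclicCount (d + 2) n := by exact_mod_cast acyclicCount_pos (d + 1) n
      have h_pos₂ : (0 : ℝ) < acyclicCount (d + 1) n := by exact_mod_cast acyclicCount_pos d n
      have h_mul : Real.log (acyclicCount (d + 2) n) + Real.log (acyclicCount (d + 1) n) ≤
          Real.log (acyclicCount (d + 2) (n + 1)) := by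
        rw [← Real.log_mul h_pos₁.ne' h_pos₂.ne']
        exact Real.log_le_log (by positivity) (by exact_mod_cast acyclicCount_mul_le (d + 1) n)
      have h_step := choose_mul_log_succ_sub_log_le d n
      have ih := ih n
      have h_harm : ∑ k ∈ Icc 1 (d + 1 + 1), (1 : ℝ) / k =
          ∑ k ∈ Icc 1 (d + 1), (1 : ℝ) / k + 1 / (d + 2) := by
        rw [sum_Icc_succ_top (by omega)]
        push_cast
        ring
      have h_div : (n.choose (d + 1) : ℝ) / (d + 2) = n.choose (d + 1) * (1 / (d + 2)) := by ring
      have h_top : ((n + 1).choose (d + 2) : ℝ) = n.choose (d + 1) + n.choose (d + 2) := by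
        exact_mod_cast Nat.choose_succ_succ' n (d + 1)
      have h_bot : ((n + 1).choose (d + 1) : ℝ) = n.choose d + n.choose (d + 1) := by
        exact_mod_cast Nat.choose_succ_succ' n d
      refine le_trans ?_ h_mul
      refine le_trans ?_ (add_le_add ihn ih)
      rw [h_div] at h_step
      rw [h_top] at h_step
      rw [show d + 1 + 1 = d + 2 from rfl] at h_harm ⊢
      rw [h_harm, h_top, h_bot]
      push_cast at h_step ⊢
      linarith

/-- for every `d ≥ 1` and every `ε > 0`, for all large enough `n`,
`a_d(n) ≥ (n/(e^{H_d}+ε))^{C(n,d)}` where `H_d = ∑_{k=1}^d 1/k`. -/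
theorem acyclicCount_lower_bound (d : ℕ) (hd : 1 ≤ d) (e : ℝ) (he : 0 < e) :
    ∃ N : ℕ, ∀ n : ℕ, N ≤ n →
      ((n : ℝ) / (Real.exp (∑ k ∈ Finset.Icc 1 d, (1 : ℝ) / k) + e)) ^ n.choose d ≤
        (acyclicCount d n : ℝ) := by
  obtain ⟨d, rfl⟩ : ∃ k, d = k + 1 := ⟨d - 1, by omega⟩
  set H : ℝ := ∑ k ∈ Finset.Icc 1 (d + 1), (1 : ℝ) / k with hH
  have h_base : 0 < Real.exp H + e := by positivity
  set δ : ℝ := Real.log (Real.exp H + e) - H with hδ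
  have hδ_pos : 0 < δ := by
    rw [hδ, sub_pos, Real.lt_log_iff_exp_lt h_base]
    linarith
  refine ⟨⌈d + d * (d + 1) / δ⌉₊ + 1, fun n hn => ?_⟩
  have hn_pos : (0 : ℝ) < n := by
    have : 0 < n := by omega
    exact_mod_cast this
  have h_large : d + d * (d + 1) / δ ≤ (n : ℝ) :=
    (Nat.le_ceil _).trans (by exact_mod_cast (Nat.le_succ _).trans hn)
  have h_dn : d ≤ n := by
    have : (d : ℝ) ≤ n := le_trans (le_add_of_nonneg_right (by positivity)) h_large
    exact_mod_cast this
  have h_err : (d : ℝ) * n.choose d ≤ n.choose (d + 1) * δ := by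
    have h_rec : (n.choose (d + 1) : ℝ) * (d + 1) = n.choose d * (n - d) := by
      have := Nat.choose_succ_right_eq n d
      rw [← Nat.cast_sub h_dn]
      exact_mod_cast this
    have h_ratio : (d : ℝ) * (d + 1) ≤ (n - d) * δ := by
      rw [← div_le_iff₀ hδ_pos]
      linarith
    have h_mul := mul_le_mul_of_nonneg_left h_ratio (Nat.cast_nonneg (α := ℝ) (n.choose d))
    refine le_of_mul_le_mul_right (a := (d + 1 : ℝ)) ?_ (by positivity)
    calc (d : ℝ) * n.choose d * (d + 1) = n.choose d * (d * (d + 1)) := by ring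
      _ ≤ n.choose d * ((n - d) * δ) := h_mul
      _ = n.choose (d + 1) * (d + 1) * δ := by rw [h_rec]; ring
      _ = n.choose (d + 1) * δ * (d + 1) := by ring
  have h_count : (0 : ℝ) < acyclicCount (d + 1) n := by exact_mod_cast acyclicCount_pos d n
  rw [← Real.log_le_log_iff (by positivity) h_count, Real.log_pow,
    Real.log_div hn_pos.ne' h_base.ne']
  refine le_trans ?_ (le_log_acyclicCount d n)
  rw [← hH, show Real.log (Real.exp H + e) = H + δ by rw [hδ]; ring]
  linarith
end

section
/- If T and S are acyclic d-tournaments on vertex set [n] with the same degree sequence, then T = S. That is, an acyclic d-tournament is uniquely determined by its degree sequence. -/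
open Finset

/-- an acyclic `d`-tournament is uniquely determined by its degree sequence. -/
theorem acyclic_eq_of_degSeq_eq (n d : ℕ) (hd : 1 ≤ d) (hn : d < n)
    (ε₁ ε₂ : Finset ℕ → ℤ)
    (h₁ : IsTournament (Finset.range n) d ε₁) (h₂ : IsTournament (Finset.range n) d ε₂)
    (ha₁ : IsAcyclic (Finset.range n) d ε₁) (ha₂ : IsAcyclic (Finset.range n) d ε₂)
    (hdeg : degSeq (Finset.range n) d ε₁ = degSeq (Finset.range n) d ε₂) :
    ε₁ = ε₂ := by
  by_contra hne
  obtain ⟨σ, hσ⟩ := Function.ne_iff.mp hne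
  -- The faces on which the two tournaments disagree form a cycle with unit coefficients.
  have hface : ∀ F, ε₁ F ≠ ε₂ F → F ⊆ range n ∧ F.card = d + 1 := fun F hF => by
    by_contra h
    exact hF (((h₁ F).2 h).trans ((h₂ F).2 h).symm)
  refine ha₁ ((powersetCard (d + 1) (range n)).filter fun F => ε₁ F ≠ ε₂ F)
    ⟨⟨σ, by simpa [mem_powersetCard, hσ] using hface σ hσ⟩, fun F hF => ?_, fun _ => 1,
      fun _ _ => one_pos, fun τ => ?_⟩
  · exact mem_powersetCard.mp (mem_filter.mp hF).1
  · have hsum : 2 * ∑ F ∈ powersetCard (d + 1) (range n) with ε₁ F ≠ ε₂ F,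
        ε₁ F * relSign τ F = 0 := by
      rw [← sub_eq_zero.mpr (congrFun hdeg τ), degSeq, degSeq, ← sum_sub_distrib, sum_filter,
        mul_sum]
      refine sum_congr rfl fun F hF => ?_
      have hF' := mem_powersetCard.mp hF
      rcases (h₁ F).1 hF' with h | h <;> rcases (h₂ F).1 hF' with h' | h' <;>
        simp [h, h'] <;> ring
    have hsum' := (mul_eq_zero.mp hsum).resolve_left two_ne_zero
    simp only [one_mul]
    exact_mod_cast hsum'
end

section
/- For all integers n > d ≥ 1, the number a_d(n) of acyclic d-tournaments on vertex set [n] satisfies a_d(n) ≤ Σ_{k=0}^{binom(n,d)} binom(binom(n,d+1), k). -/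
open Finset

/-- Any family of more than `n.choose d` faces with `d + 1` elements carries a nontrivial linear
relation between its boundary vectors. -/
lemma exists_relSign_relation (n d : ℕ) (S : Finset (Finset ℕ))
    (hS : S ⊆ (Finset.range n).powersetCard (d + 1)) (hcard : n.choose d < S.card) :
    ∃ c : Finset ℕ → ℝ, (∃ F ∈ S, c F ≠ 0) ∧
      ∀ τ : Finset ℕ, ∑ F ∈ S, c F * (relSign τ F : ℝ) = 0 := by
  classical
  let Q := (Finset.range n).powersetCard d
  have hdep : ¬ LinearIndependent ℝ
      (fun (F : S) (τ : Q) => (relSign (τ : Finset ℕ) (F : Finset ℕ) : ℝ)) := by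
    intro h
    have hle := h.fintype_card_le_finrank
    simp [Q] at hle
    omega
  obtain ⟨g, hg, F₀, hF₀⟩ := Fintype.not_linearIndependent_iff.1 hdep
  refine ⟨fun F => if hF : F ∈ S then g ⟨F, hF⟩ else 0, ⟨F₀, F₀.2, by simpa using hF₀⟩, ?_⟩
  intro τ
  by_cases hτ : τ ∈ Q
  · have hsum := congrFun hg ⟨τ, hτ⟩
    rw [← Finset.sum_coe_sort S]
    simpa [Finset.sum_apply] using hsum
  · refine Finset.sum_eq_zero fun F hF => ?_
    have hF' := Finset.mem_powersetCard.1 (hS hF)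
    have hzero : relSign τ F = 0 := by
      refine if_neg fun h => hτ (Finset.mem_powersetCard.2 ⟨h.1.trans hF'.1, ?_⟩)
      omega
    simp [hzero]

/-- If every sign pattern on a set `S` of faces extends to an acyclic tournament, then `S` has at
most `n.choose d` elements. -/
lemma card_le_choose_of_forall_sign_pattern (n d : ℕ) (S : Finset (Finset ℕ))
    (hS : S ⊆ (Finset.range n).powersetCard (d + 1))
    (h : ∀ p : Finset ℕ → Prop, ∃ ε, IsTournament (Finset.range n) d ε ∧
      IsAcyclic (Finset.range n) d ε ∧ ∀ F ∈ S, ε F = 1 ↔ p F) :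
    S.card ≤ n.choose d := by
  classical
  by_contra! hcard
  obtain ⟨c, ⟨F₀, hF₀, hc₀⟩, hc⟩ := exists_relSign_relation n d S hS hcard
  obtain ⟨ε, hT, hA, hε⟩ := h fun F => 0 < c F
  refine hA (S.filter fun F => c F ≠ 0) ⟨⟨F₀, by simp [hF₀, hc₀]⟩,
    fun F hF => Finset.mem_powersetCard.1 (hS (Finset.mem_filter.1 hF).1),
    fun F => |c F|, fun F hF => abs_pos.2 (Finset.mem_filter.1 hF).2, fun τ => ?_⟩
  refine Eq.trans ?_ (hc τ)
  rw [Finset.sum_filter]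
  refine Finset.sum_congr rfl fun F hF => ?_
  rcases lt_trichotomy (c F) 0 with hneg | hzero | hpos
  · have hsign : ε F = -1 :=
      ((hT F).1 (Finset.mem_powersetCard.1 (hS hF))).resolve_left
        fun h1 => absurd ((hε F hF).1 h1) hneg.not_gt
    simp [hneg.ne, abs_of_neg hneg, hsign]
  · simp [hzero]
  · simp [hpos.ne', abs_of_pos hpos, (hε F hF).2 hpos]

/-- A tournament is determined by its set of positive faces. -/
lemma IsTournament.ext_of_eq_one_iff {V : Finset ℕ} {d : ℕ} {ε ε' : Finset ℕ → ℤ}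
    (hε : IsTournament V d ε) (hε' : IsTournament V d ε')
    (h : ∀ F ∈ V.powersetCard (d + 1), ε F = 1 ↔ ε' F = 1) : ε = ε' := by
  funext F
  by_cases hF : F ⊆ V ∧ F.card = d + 1
  · have hiff := h F (Finset.mem_powersetCard.2 hF)
    rcases (hε F).1 hF with h1 | h1 <;> rcases (hε' F).1 hF with h2 | h2 <;> simp_all
  · rw [(hε F).2 hF, (hε' F).2 hF]

/-- for all `n > d ≥ 1`, `a_d(n) ≤ ∑_{k=0}^{C(n,d)} C(C(n,d+1), k)`. -/
theorem acyclicCount_le_chambers (n d : ℕ) (hd : 1 ≤ d) (hn : d < n) :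
    acyclicCount d n ≤
      ∑ k ∈ Finset.range (n.choose d + 1), (n.choose (d + 1)).choose k := by
  classical
  let P := (Finset.range n).powersetCard (d + 1)
  let pos : (Finset ℕ → ℤ) → Finset P := fun ε => Finset.univ.filter fun F => ε F = 1
  let 𝒜 : Finset (Finset P) := Finset.univ.filter fun s =>
    ∃ ε, (IsTournament (Finset.range n) d ε ∧ IsAcyclic (Finset.range n) d ε) ∧ pos ε = s
  have hcount : acyclicCount d n ≤ 𝒜.card := by
    rw [← Nat.card_eq_finsetCard 𝒜]
    refine Nat.card_le_card_of_injective
      (fun ε => (⟨pos ε.1, Finset.mem_filter.2 ⟨Finset.mem_univ _, ε.1, ε.2, rfl⟩⟩ : 𝒜)) ?_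
    intro ε ε' h
    refine Subtype.ext (ε.2.1.ext_of_eq_one_iff ε'.2.1 fun F hF => ?_)
    simpa [pos] using Finset.ext_iff.1 (congrArg Subtype.val h) ⟨F, hF⟩
  have hdim : 𝒜.vcDim ≤ n.choose d := by
    refine Finset.sup_le fun s hs => ?_
    rw [← Finset.card_map (Function.Embedding.subtype (· ∈ P))]
    refine card_le_choose_of_forall_sign_pattern n d _ (fun F hF => ?_) fun p => ?_
    · obtain ⟨F', -, rfl⟩ := Finset.mem_map.1 hF
      exact F'.2
    · obtain ⟨u, hu, hsu⟩ := (Finset.mem_shatterer.1 hs) (Finset.filter_subset (fun F : P => p F) s)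
      obtain ⟨ε, ⟨hT, hA⟩, rfl⟩ := (Finset.mem_filter.1 hu).2
      refine ⟨ε, hT, hA, fun F hF => ?_⟩
      obtain ⟨F', hF', rfl⟩ := Finset.mem_map.1 hF
      simpa [pos, hF'] using Finset.ext_iff.1 hsu F'
  calc acyclicCount d n ≤ 𝒜.card := hcount
    _ ≤ 𝒜.shatterer.card := Finset.card_le_card_shatterer 𝒜
    _ ≤ ∑ k ∈ Finset.Iic 𝒜.vcDim, (Fintype.card P).choose k :=
      Finset.card_shatterer_le_sum_vcDim
    _ ≤ ∑ k ∈ Finset.range (n.choose d + 1), (Fintype.card P).choose k := by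
      refine Finset.sum_le_sum_of_subset fun k hk => ?_
      have := Finset.mem_Iic.1 hk
      exact Finset.mem_range.2 (by omega)
    _ = ∑ k ∈ Finset.range (n.choose d + 1), (n.choose (d + 1)).choose k := by
      simp [P]
end

section
/- For every integer d ≥ 1 there is a constant c_d > 0 such that for every n ≥ 2, every d-tournament T on vertex set [n] has a subset S ⊆ [n] with |S| ≥ c_d·(log n)^{1/d} such that the subtournament T|_S is acyclic. -/
open Finset

/-- Adding a vertex above all vertices of `τ` induces the sign `+1` on `τ`. -/
lemma relSign_insert_of_forall_lt {τ : Finset ℕ} {x : ℕ} (h : ∀ t ∈ τ, t < x) :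
    relSign τ (insert x τ) = 1 := by
  have hx : x ∉ τ := fun hx => lt_irrefl _ (h x hx)
  have hsd : insert x τ \ τ = {x} := by
    ext a
    simp only [mem_sdiff, mem_insert, mem_singleton]
    grind
  have hf : (insert x τ).filter (fun y => y < x) = τ := by
    ext a
    simp only [mem_filter, mem_insert]
    grind
  rw [relSign, if_pos ⟨subset_insert _ _, (card_insert_of_notMem hx).symm⟩, hsd, sum_singleton,
    hf, card_insert_of_notMem hx]
  simp

/-- `A` is end-homogeneous with respect to a larger pool `W` of vertices: the sign of `τ ∪ {x}`,
for a `d`-element `τ ⊆ A` and `x ∈ W` above `τ`, depends on `τ` only. -/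
def EndHomogeneous (d : ℕ) (ε : Finset ℕ → ℤ) (A W : Finset ℕ) : Prop :=
  ∀ τ ⊆ A, τ.card = d → ∀ x ∈ W, ∀ y ∈ W, (∀ t ∈ τ, t < x) → (∀ t ∈ τ, t < y) →
    ε (insert x τ) = ε (insert y τ)

/-- A face of minimal vertex sum in a cycle would have, opposite its largest vertex, a row
all of whose entries on the cycle have the same sign. -/
lemma EndHomogeneous.isAcyclic {d : ℕ} {ε : Finset ℕ → ℤ} {A : Finset ℕ}
    (h : EndHomogeneous d ε A A) (hε : ∀ σ ⊆ A, σ.card = d + 1 → ε σ ≠ 0) :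
    IsAcyclic A d ε := by
  rintro C ⟨hne, hC, v, hv, hsum⟩
  obtain ⟨F, hF, hmin⟩ := exists_min_image C (fun F => ∑ i ∈ F, i) hne
  obtain ⟨hFA, hFcard⟩ := hC F hF
  have hFne : F.Nonempty := card_pos.mp (by omega)
  set x := F.max' hFne
  have hxF : x ∈ F := F.max'_mem hFne
  set τ := F.erase x
  have hxτ : x ∉ τ := notMem_erase x F
  have hFeq : insert x τ = F := insert_erase hxF
  have hτx : ∀ t ∈ τ, t < x := fun t ht =>
    lt_of_le_of_ne (F.le_max' t (mem_of_mem_erase ht)) (ne_of_mem_erase ht)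
  have hτcard : τ.card = d := by rw [card_erase_of_mem hxF]; omega
  have key : ∀ G ∈ C, τ ⊆ G → ε G * relSign τ G = ε F := by
    intro G hG hτG
    obtain ⟨hGA, hGcard⟩ := hC G hG
    obtain ⟨y, hy, rfl⟩ : ∃ y, y ∉ τ ∧ insert y τ = G :=
      (covBy_iff_exists_insert).mp (covBy_iff_card_sdiff_eq_one.mpr
        ⟨hτG, by rw [card_sdiff_of_subset hτG]; omega⟩)
    have hle := hmin _ hG
    rw [← hFeq, sum_insert hxτ, sum_insert hy] at hle
    have hτy : ∀ t ∈ τ, t < y := fun t ht => lt_of_lt_of_le (hτx t ht) (by omega)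
    rw [relSign_insert_of_forall_lt hτy, mul_one, ← hFeq]
    exact h τ ((erase_subset _ _).trans hFA) hτcard y (hGA (mem_insert_self _ _)) x (hFA hxF)
      hτy hτx
  have hpos : 0 < ∑ G ∈ C, v G * ((ε G : ℝ) * (relSign τ G : ℝ)) * ε F := by
    have hF0 : 0 < (ε F : ℝ) * ε F := mul_self_pos.mpr (by exact_mod_cast hε F hFA hFcard)
    have hterm : ∀ G ∈ C, τ ⊆ G → 0 < v G * ((ε G : ℝ) * (relSign τ G : ℝ)) * ε F := by
      intro G hG hτG
      have hk : (ε G : ℝ) * (relSign τ G : ℝ) = ε F := by exact_mod_cast key G hG hτG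
      rw [hk, mul_assoc]
      exact mul_pos (hv G hG) hF0
    refine sum_pos' (fun G hG => ?_) ⟨F, hF, hterm F hF (erase_subset _ _)⟩
    by_cases hτG : τ ⊆ G
    · exact (hterm G hG hτG).le
    · simp [relSign, hτG]
  rw [← sum_mul, hsum τ, zero_mul] at hpos
  exact lt_irrefl _ hpos

/-- Iterated halving: a set of size `2 ^ (r + |P|)` contains one of size `2 ^ r` on which every
predicate of the family `P` is constant. -/
lemma exists_subset_forall_iff {α ι : Type*} (p : ι → α → Prop) (P : Finset ι) :
    ∀ (r : ℕ) (B : Finset α), 2 ^ (r + P.card) ≤ B.card →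
      ∃ B' ⊆ B, 2 ^ r ≤ B'.card ∧ ∀ i ∈ P, ∀ x ∈ B', ∀ y ∈ B', p i x ↔ p i y := by
  classical
  induction P using Finset.induction_on with
  | empty => exact fun r B hB => ⟨B, Subset.rfl, by simpa using hB, by simp⟩
  | insert i P hi ih =>
    intro r B hB
    rw [card_insert_of_notMem hi, ← add_assoc, add_right_comm] at hB
    obtain ⟨B', hB', hcard, hconst⟩ := ih (r + 1) B hB
    have hsplit := card_filter_add_card_filter_not (s := B') (p i)
    rw [pow_succ] at hcard
    rcases le_total (2 ^ r) (B'.filter (p i)).card with hr | hr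
    · refine ⟨B'.filter (p i), (filter_subset _ _).trans hB', hr, fun j hj x hx y hy => ?_⟩
      rw [mem_filter] at hx hy
      rcases mem_insert.mp hj with rfl | hj
      · exact iff_of_true hx.2 hy.2
      · exact hconst j hj x hx.1 y hy.1
    · refine ⟨B'.filter (fun x => ¬ p i x), (filter_subset _ _).trans hB', by omega,
        fun j hj x hx y hy => ?_⟩
      rw [mem_filter] at hx hy
      rcases mem_insert.mp hj with rfl | hj
      · exact iff_of_false hx.2 hy.2
      · exact hconst j hj x hx.1 y hy.1

/-- The Erdős–Rado construction: vertices are picked greedily from below, and after each pick the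
pool `B` of candidates is halved once for each new `d`-element set of picked vertices. -/
lemma exists_endHomogeneous {V : Finset ℕ} {d : ℕ} {ε : Finset ℕ → ℤ}
    (hε : IsTournament V (d + 1) ε) (m : ℕ) :
    ∀ r : ℕ, 2 ^ (m + m.choose (d + 1) + r) ≤ V.card →
      ∃ A B : Finset ℕ, A ∪ B ⊆ V ∧ A.card = m ∧ 2 ^ r ≤ B.card ∧ (∀ a ∈ A, ∀ b ∈ B, a < b) ∧
        EndHomogeneous (d + 1) ε A (A ∪ B) := by
  induction m with
  | zero =>
    intro r hr
    refine ⟨∅, V, by simp, rfl, by simpa using hr, by simp, fun τ hτ hcard => ?_⟩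
    simp [subset_empty.mp hτ] at hcard
  | succ m ih =>
    intro r hr
    obtain ⟨A, B, hV, hA, hB, hlt, hhom⟩ := ih (r + m.choose d + 1) (by
      convert hr using 2
      rw [Nat.choose_succ_succ]
      ring)
    have hBne : B.Nonempty := card_pos.mp (lt_of_lt_of_le (by positivity) hB)
    set b := B.min' hBne
    have hbB : b ∈ B := B.min'_mem hBne
    have hbA : b ∉ A := fun hb => lt_irrefl _ (hlt b hb b hbB)
    obtain ⟨B', hB', hcard, hconst⟩ := exists_subset_forall_iff
      (fun τ x => ε (insert x (insert b τ)) = 1) (A.powersetCard d) r (B.erase b) (by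
        rw [card_powersetCard, hA, card_erase_of_mem hbB]
        rw [pow_succ] at hB
        have := Nat.one_le_two_pow (n := r + m.choose d)
        omega)
    have hbB' : ∀ y ∈ B', b < y := fun y hy =>
      lt_of_le_of_ne (B.min'_le y (mem_of_mem_erase (hB' hy))) (ne_of_mem_erase (hB' hy)).symm
    have hsub : insert b A ∪ B' ⊆ A ∪ B := by
      intro a ha
      simp only [mem_union, mem_insert] at ha ⊢
      rcases ha with (rfl | ha) | ha
      · exact Or.inr hbB
      · exact Or.inl ha
      · exact Or.inr (mem_of_mem_erase (hB' ha))
    refine ⟨insert b A, B', hsub.trans hV, by rw [card_insert_of_notMem hbA, hA], hcard, ?_, ?_⟩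
    · intro a ha y hy
      rcases mem_insert.mp ha with rfl | ha
      · exact hbB' y hy
      · exact hlt a ha y (mem_of_mem_erase (hB' hy))
    · intro τ hτ hτcard x hx y hy hτx hτy
      by_cases hbτ : b ∈ τ
      · have above : ∀ z ∈ insert b A ∪ B', (∀ t ∈ τ, t < z) → z ∈ B' := by
          intro z hz hτz
          have hbz := hτz b hbτ
          simp only [mem_union, mem_insert] at hz
          rcases hz with (rfl | hz) | hz
          · exact absurd hbz (lt_irrefl _)
          · exact absurd (hlt z hz b hbB) hbz.asymm
          · exact hz
        have sign : ∀ z ∈ insert b A ∪ B', (∀ t ∈ τ, t < z) →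
            ε (insert z τ) = 1 ∨ ε (insert z τ) = -1 := by
          intro z hz hτz
          refine (hε _).1 ⟨insert_subset ((hsub.trans hV) hz) (hτ.trans
            (subset_union_left.trans (hsub.trans hV))), ?_⟩
          rw [card_insert_of_notMem fun hzτ => lt_irrefl _ (hτz z hzτ), hτcard]
        have hiff := hconst (τ.erase b) (mem_powersetCard.mpr
          ⟨fun t ht => (mem_insert.mp (hτ (mem_of_mem_erase ht))).resolve_left (ne_of_mem_erase ht),
            by rw [card_erase_of_mem hbτ, hτcard]; rfl⟩) x (above x hx hτx) y (above y hy hτy)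
        simp only [insert_erase hbτ] at hiff
        rcases sign x hx hτx with h1 | h1 <;> rcases sign y hy hτy with h2 | h2 <;>
          simp_all
      · refine hhom τ (fun t ht => (mem_insert.mp (hτ ht)).resolve_left ?_) hτcard x (hsub hx)
          y (hsub hy) hτx hτy
        rintro rfl
        exact hbτ ht

lemma EndHomogeneous.isAcyclic_restrict {V A : Finset ℕ} {d : ℕ} {ε : Finset ℕ → ℤ}
    (hε : IsTournament V d ε) (hA : A ⊆ V) (h : EndHomogeneous d ε A A) :
    IsAcyclic A d (restrict A ε) := by
  refine EndHomogeneous.isAcyclic (fun τ hτ hcard x hx y hy hτx hτy => ?_) fun σ hσ hcard => ?_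
  · rw [_root_.restrict, _root_.restrict, if_pos (insert_subset hx hτ), if_pos (insert_subset hy hτ)]
    exact h τ hτ hcard x hx y hy hτx hτy
  · rw [_root_.restrict, if_pos hσ]
    rcases (hε σ).1 ⟨hσ.trans hA, hcard⟩ with h | h <;> simp [h]

/-- every `d`-tournament on `[n]` has an acyclic subtournament on
`≥ c_d · (log n)^{1/d}` vertices. -/
theorem exists_large_acyclic_subtournament (d : ℕ) (hd : 1 ≤ d) :
    ∃ c : ℝ, 0 < c ∧ ∀ n : ℕ, 2 ≤ n → ∀ ε : Finset ℕ → ℤ,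
      IsTournament (Finset.range n) d ε →
      ∃ S ⊆ Finset.range n,
        c * Real.log n ^ ((1 : ℝ) / d) ≤ (S.card : ℝ) ∧ IsAcyclic S d (restrict S ε) := by
  obtain ⟨d, rfl⟩ : ∃ k, d = k + 1 := ⟨d - 1, by omega⟩
  set e : ℝ := (1 : ℝ) / ((d + 1 : ℕ) : ℝ) with he
  refine ⟨(1 / 2) ^ e / 2, by positivity, fun n hn ε hε => ?_⟩
  have hn1 : (1 : ℝ) ≤ n := by exact_mod_cast (by omega : 1 ≤ n)
  have hlog : 0 ≤ Real.log n := Real.log_nonneg hn1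
  set x : ℝ := (Real.log n / 2) ^ e with hx
  have hx0 : 0 ≤ x := by positivity
  have hxpow : x ^ (d + 1) = Real.log n / 2 := by
    rw [hx, he, one_div, Real.rpow_inv_natCast_pow (by positivity) (by omega)]
  have hgoal : (1 / 2 : ℝ) ^ e / 2 * Real.log n ^ e = x / 2 := by
    rw [hx, show Real.log n / 2 = 1 / 2 * Real.log n by ring,
      Real.mul_rpow (by norm_num) hlog]
    ring
  rw [hgoal]
  have hfloor := Nat.lt_floor_add_one x
  rcases Nat.eq_zero_or_pos ⌊x⌋₊ with hm | hm
  · have hsub : ({0} : Finset ℕ) ⊆ range n := by simp; omega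
    refine ⟨{0}, hsub, ?_, EndHomogeneous.isAcyclic_restrict hε hsub ?_⟩
    · rw [hm] at hfloor
      norm_num at hfloor ⊢
      linarith
    · intro τ _ _ a ha b hb _ _
      rw [mem_singleton.mp ha, mem_singleton.mp hb]
  · set m := ⌊x⌋₊
    have hmx : (m : ℝ) ≤ x := Nat.floor_le hx0
    have hexp : m + m.choose (d + 1) + 0 ≤ 2 * m ^ (d + 1) := by
      have h1 := Nat.choose_le_pow m (d + 1)
      have h2 := Nat.le_self_pow (n := d + 1) (by omega) m
      omega
    have hcard : 2 ^ (m + m.choose (d + 1) + 0) ≤ (range n).card := by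
      rw [card_range]
      refine (Nat.pow_le_pow_right two_pos hexp).trans ?_
      have hreal : (2 : ℝ) ^ (2 * m ^ (d + 1)) ≤ n := by
        rw [← Real.log_le_log_iff (by positivity) (by linarith), Real.log_pow]
        have hpow : (m : ℝ) ^ (d + 1) ≤ Real.log n / 2 :=
          hxpow ▸ pow_le_pow_left₀ (Nat.cast_nonneg m) hmx _
        have hlog2 : Real.log 2 ≤ 1 := by linarith [Real.log_two_lt_d9]
        push_cast
        calc 2 * (m : ℝ) ^ (d + 1) * Real.log 2 ≤ 2 * (m : ℝ) ^ (d + 1) * 1 := by gcongr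
          _ ≤ Real.log n := by linarith
      exact_mod_cast hreal
    obtain ⟨A, B, hV, hA, -, -, hhom⟩ := exists_endHomogeneous hε m 0 hcard
    have hAV := subset_union_left.trans hV
    refine ⟨A, hAV, ?_, EndHomogeneous.isAcyclic_restrict hε hAV
      fun τ hτ hτcard a ha b hb =>
        hhom τ hτ hτcard a (mem_union_left _ ha) b (mem_union_left _ hb)⟩
    rw [hA]
    have : (1 : ℝ) ≤ m := by exact_mod_cast hm
    linarith
end

section
/- For every integer d ≥ 1 there is a constant C_d > 0 such that for all sufficiently large n there exists a d-tournament T on vertex set [n] with the property that every subset S ⊆ [n] for which the subtournament T|_S is acyclic satisfies |S| ≤ C_d·(log n)^{1/d}. -/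
open Finset

/-- The `±1` function on the set `E` of faces taking the value `1` exactly on `P`,
extended by `0` outside `E`. -/
def signOn (E P : Finset (Finset ℕ)) : Finset ℕ → ℤ :=
  fun F => if F ∈ E then (if F ∈ P then 1 else -1) else 0

lemma isTournament_signOn (V : Finset ℕ) (d : ℕ) (P : Finset (Finset ℕ)) :
    IsTournament V d (signOn (V.powersetCard (d + 1)) P) := by
  intro σ
  simp only [signOn, mem_powersetCard]
  grind

lemma restrict_signOn {V S : Finset ℕ} (hS : S ⊆ V) (d : ℕ) (P : Finset (Finset ℕ)) :
    restrict S (signOn (V.powersetCard (d + 1)) P) =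
      signOn (S.powersetCard (d + 1)) (P ∩ S.powersetCard (d + 1)) := by
  funext σ
  simp only [_root_.restrict, signOn, mem_powersetCard, mem_inter]
  by_cases h : σ ⊆ S
  · by_cases hσ : #σ = d + 1 <;> simp [h, h.trans hS, hσ]
  · simp [h]

lemma IsAcyclic.restrict_mono {S S' : Finset ℕ} {d : ℕ} {ε : Finset ℕ → ℤ} (hS : S' ⊆ S)
    (h : IsAcyclic S d (restrict S ε)) : IsAcyclic S' d (restrict S' ε) := by
  rintro C ⟨hne, hC, v, hv, hsum⟩
  refine h C ⟨hne, fun F hF => ⟨(hC F hF).1.trans hS, (hC F hF).2⟩, v, hv, fun τ => ?_⟩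
  rw [← hsum τ]
  refine sum_congr rfl fun F hF => ?_
  simp [_root_.restrict, (hC F hF).1, (hC F hF).1.trans hS]

/-- The columns of more faces than there are rows are linearly dependent, so some choice of
signs on these faces forces a cycle. -/
lemma exists_signs_not_isAcyclic {V : Finset ℕ} {d : ℕ} {K : Finset (Finset ℕ)}
    (hK : K ⊆ V.powersetCard (d + 1)) (hcard : (#V).choose d < #K) :
    ∃ P ⊆ K, ∀ ε : Finset ℕ → ℤ, (∀ F ∈ K, ε F = if F ∈ P then 1 else -1) →
      ¬ IsAcyclic V d ε := by
  have hdep : ¬ LinearIndepOn ℝ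
      (fun (F : Finset ℕ) (τ : V.powersetCard d) => (relSign τ F : ℝ)) (K : Set (Finset ℕ)) := by
    intro h
    have := LinearIndependent.fintype_card_le_finrank h
    simp at this
    omega
  rw [linearIndepOn_finset_iff] at hdep
  push Not at hdep
  obtain ⟨f, hf, F₀, hF₀, hne⟩ := hdep
  refine ⟨{F ∈ K | 0 < f F}, filter_subset _ _, fun ε hε hac => ?_⟩
  refine hac {F ∈ K | f F ≠ 0} ⟨⟨F₀, by simp [hF₀, hne]⟩, fun F hF => ?_, fun F => |f F|,
    fun F hF => abs_pos.2 (mem_filter.1 hF).2, fun τ => ?_⟩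
  · exact mem_powersetCard.1 (hK (mem_filter.1 hF).1)
  have hmul : ∀ F ∈ K, |f F| * ((ε F : ℝ) * (relSign τ F : ℝ)) = f F * relSign τ F := by
    intro F hF
    rw [hε F hF]
    by_cases h : 0 < f F
    · simp [hF, h, abs_of_pos h]
    · simp [h, abs_of_nonpos (not_lt.1 h)]
  rw [sum_filter_of_ne (p := fun F => f F ≠ 0) fun F _ h h0 => h (by simp [h0]),
    sum_congr rfl hmul]
  by_cases hτ : τ ∈ V.powersetCard d
  · simpa using congr_fun hf ⟨τ, hτ⟩
  · refine sum_eq_zero fun F hF => ?_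
    have hF' := mem_powersetCard.1 (hK hF)
    have : relSign τ F = 0 := by
      refine if_neg fun h => hτ (mem_powersetCard.2 ⟨h.1.trans hF'.1, ?_⟩)
      omega
    simp [this]

lemma sum_choose_le_add_one_pow (N r : ℕ) :
    ∑ i ∈ range (r + 1), N.choose i ≤ (N + 1) ^ r := by
  rw [add_pow]
  refine sum_le_sum fun i hi => ?_
  have : 1 ≤ r.choose i := Nat.choose_pos (by simpa [Nat.lt_succ_iff] using hi)
  simpa using Nat.mul_le_mul (N.choose_le_pow i) this

/-- The Sauer–Shelah lemma bounds the number of acyclic tournaments. -/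
lemma card_isAcyclic_le {V : Finset ℕ} {d : ℕ} (𝒜 : Finset (Finset (Finset ℕ)))
    (h𝒜 : ∀ P ∈ 𝒜, P ⊆ V.powersetCard (d + 1) ∧
      IsAcyclic V d (signOn (V.powersetCard (d + 1)) P)) :
    #𝒜 ≤ ((#V).choose (d + 1) + 1) ^ (#V).choose d := by
  refine (card_le_card_shatterer 𝒜).trans (le_trans ?_ (sum_choose_le_add_one_pow _ _))
  have hsub : 𝒜.shatterer ⊆ (range ((#V).choose d + 1)).biUnion
      fun i => (V.powersetCard (d + 1)).powersetCard i := by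
    intro K hK
    rw [mem_shatterer] at hK
    have hKV : K ⊆ V.powersetCard (d + 1) := by
      obtain ⟨u, hu, hKu⟩ := hK.exists_superset
      exact hKu.trans (h𝒜 u hu).1
    simp only [mem_biUnion, mem_range, mem_powersetCard]
    refine ⟨#K, ?_, hKV, rfl⟩
    by_contra! hlt
    obtain ⟨P, hPK, hP⟩ := exists_signs_not_isAcyclic hKV (Nat.lt_of_succ_le hlt)
    obtain ⟨Q, hQ, hKQ⟩ := hK hPK
    refine hP _ (fun F hF => ?_) (h𝒜 Q hQ).2
    simp only [signOn, hKV hF, if_true, ← hKQ, mem_inter, hF, true_and]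
  refine (card_le_card hsub).trans (card_biUnion_le.trans (le_of_eq ?_))
  simp

open Classical in
lemma card_filter_isAcyclic_le {V S : Finset ℕ} (hS : S ⊆ V) (d : ℕ) :
    #{P ∈ (V.powersetCard (d + 1)).powerset |
        IsAcyclic S d (restrict S (signOn (V.powersetCard (d + 1)) P))} ≤
      ((#S).choose (d + 1) + 1) ^ (#S).choose d *
        2 ^ ((#V).choose (d + 1) - (#S).choose (d + 1)) := by
  set E := V.powersetCard (d + 1)
  set E' := S.powersetCard (d + 1)
  have hE : E' ⊆ E := powersetCard_mono hS
  have hcard : #(E \ E').powerset = 2 ^ ((#V).choose (d + 1) - (#S).choose (d + 1)) := by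
    rw [card_powerset, card_sdiff_of_subset hE, card_powersetCard, card_powersetCard]
  rw [← hcard]
  refine le_trans ?_ (Nat.mul_le_mul_right _ (card_isAcyclic_le (V := S) (d := d)
    {Q ∈ E'.powerset | IsAcyclic S d (signOn E' Q)} fun P hP => by simpa using hP))
  rw [← card_product]
  refine card_le_card_of_injOn (fun P => (P ∩ E', P \ E')) (fun P hP => ?_) fun P _ Q _ h => ?_
  · simp only [coe_filter, Set.mem_ofPred_eq, mem_powerset] at hP
    rw [restrict_signOn hS] at hP
    simp only [coe_product, Set.mem_prod, mem_coe, mem_filter, mem_powerset]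
    exact ⟨⟨inter_subset_right, hP.2⟩, sdiff_subset_sdiff hP.1 le_rfl⟩
  · simp only [Prod.mk.injEq] at h
    rw [← sdiff_union_inter P E', h.1, h.2, sdiff_union_inter]

lemma exists_tournament_forall_not_isAcyclic {d m n : ℕ}
    (h : n ^ m * (m.choose (d + 1) + 1) ^ m.choose d < 2 ^ m.choose (d + 1)) :
    ∃ ε : Finset ℕ → ℤ, IsTournament (range n) d ε ∧
      ∀ S ∈ (range n).powersetCard m, ¬ IsAcyclic S d (restrict S ε) := by
  classical
  obtain hmn | hmn := lt_or_ge n m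
  · refine ⟨_, isTournament_signOn _ d ∅, fun S hS => ?_⟩
    simp [powersetCard_eq_empty.2 (show #(range n) < m by simpa)] at hS
  set E := (range n).powersetCard (d + 1)
  set bad := ((range n).powersetCard m).biUnion fun S =>
    {P ∈ E.powerset | IsAcyclic S d (restrict S (signOn E P))}
  have hbad : #bad < #E.powerset := by
    refine (card_biUnion_le_card_mul _ _ ((m.choose (d + 1) + 1) ^ m.choose d *
      2 ^ (n.choose (d + 1) - m.choose (d + 1))) fun S hS => ?_).trans_lt ?_
    · obtain ⟨hSn, rfl⟩ := mem_powersetCard.1 hS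
      simpa using card_filter_isAcyclic_le hSn d
    · have hle : m.choose (d + 1) ≤ n.choose (d + 1) := Nat.choose_le_choose _ hmn
      rw [card_powerset, card_powersetCard, card_powersetCard, card_range, ← mul_assoc,
        ← Nat.add_sub_cancel' hle, pow_add, Nat.add_sub_cancel_left]
      exact Nat.mul_lt_mul_of_pos_right
        ((Nat.mul_le_mul_right _ (n.choose_le_pow m)).trans_lt h) (by positivity)
  obtain ⟨P, hP, hPbad⟩ := exists_mem_notMem_of_card_lt_card hbad
  refine ⟨signOn E P, isTournament_signOn _ d P, fun S hS hac => hPbad ?_⟩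
  exact mem_biUnion.2 ⟨S, hS, mem_filter.2 ⟨hP, hac⟩⟩

open Filter in
lemma eventually_choose_succ_add_one_pow_lt (d : ℕ) :
    ∀ᶠ m : ℕ in atTop,
      ((m.choose (d + 1) + 1) ^ m.choose d) ^ 2 < 2 ^ m.choose (d + 1) := by
  have hlim := (tendsto_pow_const_div_const_pow_of_one_lt (2 * (d + 1) ^ 2)
    (one_lt_two (α := ℝ))).comp (tendsto_add_atTop_nat 1)
  filter_upwards [hlim.eventually (gt_mem_nhds (show (0 : ℝ) < 1 / 2 ^ (d + 1) by positivity)),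
    eventually_ge_atTop d] with m hm hdm
  have hpoly : (m + 1) ^ (2 * (d + 1) ^ 2) < 2 ^ (m - d) := by
    simp only [Function.comp_apply] at hm
    rw [div_lt_div_iff₀ (by positivity) (by positivity), one_mul,
      show (2 : ℝ) ^ (m + 1) = 2 ^ (m - d) * 2 ^ (d + 1) by rw [← pow_add]; congr 1; omega] at hm
    exact_mod_cast lt_of_mul_lt_mul_right hm (by positivity)
  have hle : m.choose (d + 1) + 1 ≤ (m + 1) ^ (d + 1) :=
    (Nat.add_le_add_right (m.choose_le_pow (d + 1)) 1).trans
      (by simpa using pow_add_pow_le (Nat.zero_le m) zero_le_one (Nat.succ_ne_zero d))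
  refine lt_of_pow_lt_pow_left₀ (d + 1) (Nat.zero_le _) ?_
  calc (((m.choose (d + 1) + 1) ^ m.choose d) ^ 2) ^ (d + 1)
      ≤ ((((m + 1) ^ (d + 1)) ^ m.choose d) ^ 2) ^ (d + 1) := by gcongr
    _ = ((m + 1) ^ (2 * (d + 1) ^ 2)) ^ m.choose d := by
      simp only [← pow_mul]
      congr 1
      ring
    _ < (2 ^ (m - d)) ^ m.choose d := Nat.pow_lt_pow_left hpoly (Nat.choose_pos hdm).ne'
    _ = (2 ^ m.choose (d + 1)) ^ (d + 1) := by
      rw [← pow_mul, ← pow_mul, Nat.choose_succ_right_eq, mul_comm]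

lemma pow_two_le_two_pow_choose {d m n : ℕ} (hn : 1 ≤ n) (hm : 2 * d ≤ m)
    (h : 2 ^ (d + 3) * ((d + 1).factorial : ℝ) * Real.log n ≤ (m : ℝ) ^ d) :
    (n ^ m) ^ 2 ≤ 2 ^ m.choose (d + 1) := by
  have hchoose : (m : ℝ) ^ (d + 1) ≤ 2 ^ (d + 1) * ((d + 1).factorial * m.choose (d + 1)) := by
    have h1 := Nat.pow_sub_le_descFactorial m (d + 1)
    rw [Nat.descFactorial_eq_factorial_mul_choose, Nat.add_sub_add_right] at h1
    have h2 : m ^ (d + 1) ≤ 2 ^ (d + 1) * (m - d) ^ (d + 1) := by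
      rw [← mul_pow]
      exact Nat.pow_le_pow_left (by omega) _
    exact_mod_cast h2.trans (Nat.mul_le_mul_left _ h1)
  have hlog : 2 * m * Real.log n ≤ m.choose (d + 1) * (1 / 2) := by
    have hpos : (0 : ℝ) < 2 ^ (d + 1) * (d + 1).factorial := by positivity
    refine le_of_mul_le_mul_left ?_ hpos
    have hmul := mul_le_mul_of_nonneg_left h (Nat.cast_nonneg (α := ℝ) m)
    rw [← pow_succ'] at hmul
    have := hmul.trans hchoose
    rw [show (2 : ℝ) ^ (d + 3) = 2 ^ (d + 1) * 4 by ring] at this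
    linarith
  have hreal : ((n : ℝ) ^ m) ^ 2 ≤ 2 ^ m.choose (d + 1) := by
    rw [← Real.log_le_log_iff (by positivity) (by positivity)]
    simp only [Real.log_pow]
    have := mul_le_mul_of_nonneg_left
      (show (1 / 2 : ℝ) ≤ Real.log 2 by linarith [Real.log_two_gt_d9])
      (Nat.cast_nonneg (α := ℝ) (m.choose (d + 1)))
    push_cast
    linarith
  exact_mod_cast hreal

/-- for all large `n` there is a `d`-tournament on `[n]` all of whose
acyclic subtournaments have `≤ C_d · (log n)^{1/d}` vertices. -/
theorem exists_tournament_small_acyclic_subtournaments (d : ℕ) (hd : 1 ≤ d) :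
    ∃ C : ℝ, 0 < C ∧ ∃ N : ℕ, ∀ n : ℕ, N ≤ n →
      ∃ ε : Finset ℕ → ℤ, IsTournament (Finset.range n) d ε ∧
        ∀ S ⊆ Finset.range n, IsAcyclic S d (restrict S ε) →
          (S.card : ℝ) ≤ C * Real.log n ^ ((1 : ℝ) / d) := by
  obtain ⟨C, hC⟩ : ∃ C : ℝ, C = 2 ^ (d + 3) * (d + 1).factorial := ⟨_, rfl⟩
  have hC1 : 1 ≤ C := by
    have : 1 ≤ 2 ^ (d + 3) * (d + 1).factorial := Nat.succ_le_of_lt (by positivity)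
    rw [hC]
    exact_mod_cast this
  have hdpos : (0 : ℝ) < 1 / d := by positivity
  have hlim : Filter.Tendsto (fun n : ℕ => ⌈C * Real.log n ^ ((1 : ℝ) / d)⌉₊)
      Filter.atTop Filter.atTop :=
    tendsto_nat_ceil_atTop.comp (Filter.Tendsto.const_mul_atTop (by positivity)
      ((tendsto_rpow_atTop hdpos).comp
        (Real.tendsto_log_atTop.comp tendsto_natCast_atTop_atTop)))
  obtain ⟨N, hN⟩ := Filter.eventually_atTop.1
    ((hlim.eventually (eventually_choose_succ_add_one_pow_lt d)).and
      ((hlim.eventually (Filter.eventually_ge_atTop (2 * d))).and (Filter.eventually_ge_atTop 1)))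
  refine ⟨C, by positivity, N, fun n hn => ?_⟩
  obtain ⟨hlt, hdm, hn1⟩ := hN n hn
  set m := ⌈C * Real.log n ^ ((1 : ℝ) / d)⌉₊
  have hlog : 0 ≤ Real.log n := Real.log_natCast_nonneg n
  have hpow : C * Real.log n ≤ (m : ℝ) ^ d :=
    calc C * Real.log n ≤ C ^ d * Real.log n := by
          gcongr
          exact le_self_pow₀ hC1 (by omega)
      _ = (C * Real.log n ^ ((1 : ℝ) / d)) ^ d := by
          rw [mul_pow, one_div, Real.rpow_inv_natCast_pow hlog (by omega)]
      _ ≤ (m : ℝ) ^ d := by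
          gcongr
          exact Nat.le_ceil _
  have hcount : n ^ m * (m.choose (d + 1) + 1) ^ m.choose d < 2 ^ m.choose (d + 1) := by
    refine lt_of_pow_lt_pow_left₀ 2 (Nat.zero_le _) ?_
    rw [mul_pow, pow_two (2 ^ _)]
    exact Nat.mul_lt_mul_of_le_of_lt (pow_two_le_two_pow_choose hn1 hdm (hC ▸ hpow)) hlt (by positivity)
  obtain ⟨ε, hε, hS⟩ := exists_tournament_forall_not_isAcyclic hcount
  refine ⟨ε, hε, fun S hSn hac => ?_⟩
  have hcard : #S < m := by
    by_contra! hle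
    obtain ⟨S', hS', hcard'⟩ := exists_subset_card_eq hle
    exact hS S' (mem_powersetCard.2 ⟨hS'.trans hSn, hcard'⟩) (hac.restrict_mono hS')
  exact (Nat.lt_ceil.1 hcard).le
end

section
/- For every integer d ≥ 1 there is a constant c_d > 0 such that for all sufficiently large k the following holds with n = ⌊2^{c_d·k^d}⌋: there exists a red/blue coloring of the (d+2)-element subsets of [n] such that no (d+3)-element subset of [n] has all of its (d+2)-element subsets colored red, and no k-element subset of [n] has all of its (d+2)-element subsets colored blue. Equivalently, the hypergraph Ramsey number satisfies R_{d+2}(d+3, k) > 2^{c_d·k^d}. -/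
open Finset

/-- If the sets `A i` are pairwise disjoint, then few subsets `e` of `X` avoid all of the
prescribed traces `P i` on `A i`. -/
theorem card_filter_inter_ne_le {α ι : Type*} [DecidableEq α] [DecidableEq ι]
    (X : Finset α) (a : ℕ) (A P : ι → Finset α) (T : Finset ι)
    (hAX : ∀ i ∈ T, A i ⊆ X) (hA : ∀ i ∈ T, (A i).card ≤ a) (hP : ∀ i ∈ T, P i ⊆ A i)
    (hdisj : ∀ i ∈ T, ∀ j ∈ T, i ≠ j → Disjoint (A i) (A j)) :
    ((X.powerset.filter (fun e => ∀ i ∈ T, e ∩ A i ≠ P i)).card : ℝ) ≤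
      (1 - (2 ^ a)⁻¹) ^ T.card * 2 ^ X.card := by
  induction T using Finset.induction_on with
  | empty => simp
  | insert j T hj ih =>
    have ih := ih (fun i hi => hAX i (mem_insert_of_mem hi))
      (fun i hi => hA i (mem_insert_of_mem hi)) (fun i hi => hP i (mem_insert_of_mem hi))
      (fun i hi k hk => hdisj i (mem_insert_of_mem hi) k (mem_insert_of_mem hk))
    set B := X.powerset.filter (fun e => ∀ i ∈ T, e ∩ A i ≠ P i) with hB
    have hsplit : X.powerset.filter (fun e => ∀ i ∈ insert j T, e ∩ A i ≠ P i) =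
        B.filter (fun e => ¬ e ∩ A j = P j) := by
      ext e
      simp only [hB, mem_filter, mem_insert, forall_eq_or_imp]
      tauto
    have hPj := hP j (mem_insert_self _ _)
    have hAXj := hAX j (mem_insert_self _ _)
    have hcard : B.card ≤ (B.filter (fun e => e ∩ A j = P j) ×ˢ (A j).powerset).card := by
      refine card_le_card_of_injOn (fun e => (e \ A j ∪ P j, e ∩ A j)) ?_ ?_
      · intro e he
        simp only [hB, coe_filter, Set.mem_ofPred_eq, mem_powerset] at he
        simp only [hB, coe_product, Set.mem_prod, mem_coe, mem_filter, mem_powerset]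
        refine ⟨⟨⟨?_, ?_⟩, ?_⟩, inter_subset_right⟩
        · exact union_subset (sdiff_subset.trans he.1) (hPj.trans hAXj)
        · intro i hi
          have hd := hdisj i (mem_insert_of_mem hi) j (mem_insert_self _ _)
            (fun h => hj (h ▸ hi))
          have : (e \ A j ∪ P j) ∩ A i = e ∩ A i := by
            ext x
            have h1 := fun h : x ∈ A i => disjoint_left.1 hd h
            have h2 := @hPj x
            simp only [mem_inter, mem_union, mem_sdiff]
            tauto
          rw [this]
          exact he.2 i hi
        · ext x
          have h2 := @hPj x
          simp only [mem_inter, mem_union, mem_sdiff]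
          tauto
      · intro e _ e' _ h
        simp only [Prod.mk.injEq] at h
        ext x
        have h1 := Finset.ext_iff.1 h.1 x
        have h2 := Finset.ext_iff.1 h.2 x
        have h3 := @hPj x
        simp only [mem_inter, mem_union, mem_sdiff] at h1 h2
        tauto
    rw [card_product, card_powerset] at hcard
    have hpow : (2 : ℝ) ^ (A j).card ≤ 2 ^ a :=
      pow_le_pow_right₀ (by norm_num) (hA j (mem_insert_self _ _))
    have hcard' : (B.card : ℝ) ≤ (B.filter (fun e => e ∩ A j = P j)).card * 2 ^ a := by
      refine le_trans (by exact_mod_cast hcard) (mul_le_mul_of_nonneg_left hpow (by positivity))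
    have hsum : ((B.filter (fun e => e ∩ A j = P j)).card : ℝ) +
        (B.filter (fun e => ¬ e ∩ A j = P j)).card = B.card := by
      exact_mod_cast card_filter_add_card_filter_not (s := B) (fun e => e ∩ A j = P j)
    rw [hsplit, card_insert_of_notMem hj, pow_succ]
    have h2a : (0 : ℝ) < 2 ^ a := by positivity
    have hinv : (B.card : ℝ) * (2 ^ a)⁻¹ ≤ (B.filter (fun e => e ∩ A j = P j)).card := by
      rwa [← div_eq_mul_inv, div_le_iff₀ h2a]
    have h1 : (0 : ℝ) ≤ 1 - (2 ^ a)⁻¹ :=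
      sub_nonneg.2 (inv_le_one_of_one_le₀ (one_le_pow₀ (by norm_num)))
    nlinarith [mul_le_mul_of_nonneg_right ih h1]

/-- The family of facets `U \ {x}` of `U`. -/
def facets (U : Finset ℕ) : Finset (Finset ℕ) := U.image U.erase

/-- The facets of `U` obtained by deleting an element of even rank. -/
def evenFacets (U : Finset ℕ) : Finset (Finset ℕ) :=
  (U.filter fun x => Even (U.filter (· < x)).card).image U.erase

/-- The facets of `U`, oriented according to membership in `e`, form a cycle. -/
def Alternates (e : Finset (Finset ℕ)) (U : Finset ℕ) : Prop :=
  ∀ x ∈ U, ∀ y ∈ U, ((U.erase x ∈ e ↔ Even (U.filter (· < x)).card) ↔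
    (U.erase y ∈ e ↔ Even (U.filter (· < y)).card))

theorem alternates_of_inter_facets {e : Finset (Finset ℕ)} {U : Finset ℕ}
    (h : e ∩ facets U = evenFacets U) : Alternates e U := by
  have key : ∀ x ∈ U, (U.erase x ∈ e ↔ Even (U.filter (· < x)).card) := by
    intro x hx
    have h1 := Finset.ext_iff.1 h (U.erase x)
    have h2 : U.erase x ∈ facets U := mem_image_of_mem _ hx
    have h3 : U.erase x ∈ evenFacets U ↔ Even (U.filter (· < x)).card := by
      constructor
      · intro h
        obtain ⟨y, hy, hxy⟩ := mem_image.1 h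
        rw [mem_filter] at hy
        rw [← erase_injOn U hy.1 hx hxy]
        exact hy.2
      · intro h
        exact mem_image_of_mem _ (mem_filter.2 ⟨hx, h⟩)
    rw [mem_inter] at h1
    tauto
  intro x hx y hy
  exact iff_of_true (key x hx) (key y hy)

theorem card_filter_erase_lt_of_le {W : Finset ℕ} {x y : ℕ} (h : x ≤ y) :
    ((W.erase y).filter (· < x)).card = (W.filter (· < x)).card := by
  rw [filter_erase, erase_eq_of_notMem]
  simp [h]

theorem card_filter_erase_lt_of_lt {W : Finset ℕ} {x y : ℕ} (hx : x ∈ W) (h : x < y) :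
    ((W.erase x).filter (· < y)).card + 1 = (W.filter (· < y)).card := by
  rw [filter_erase, card_erase_add_one]
  simp [h, hx]

/-- Among three subsets of codimension one in `W`, some set does not alternate. -/
theorem exists_erase_not_alternates (e : Finset (Finset ℕ)) {W : Finset ℕ} (hW : 3 ≤ W.card) :
    ∃ x ∈ W, ¬ Alternates e (W.erase x) := by
  by_contra! hall
  obtain ⟨V, hVW, hV⟩ := exists_subset_card_eq hW
  let f := V.orderEmbOfFin hV
  have hf : ∀ i, f i ∈ W := fun i => hVW (orderEmbOfFin_mem V hV i)
  have hlt : ∀ i j : Fin 3, i < j → f i < f j := fun i j hij => f.strictMono hij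
  obtain ⟨x, y, z, hx, hy, hz, hxy, hyz⟩ : ∃ x y z, x ∈ W ∧ y ∈ W ∧ z ∈ W ∧ x < y ∧ y < z :=
    ⟨f 0, f 1, f 2, hf 0, hf 1, hf 2, hlt 0 1 (by decide), hlt 1 2 (by decide)⟩
  have hxz := hxy.trans hyz
  have h1 := hall x hx y (by simp [hy, hxy.ne']) z (by simp [hz, hxz.ne'])
  have h2 := hall y hy x (by simp [hx, hxy.ne]) z (by simp [hz, hyz.ne'])
  have h3 := hall z hz x (by simp [hx, hxz.ne]) y (by simp [hy, hyz.ne])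
  rw [erase_right_comm (a := y) (b := x)] at h2
  rw [erase_right_comm (a := z) (b := x), erase_right_comm (a := z) (b := y)] at h3
  rw [card_filter_erase_lt_of_le hxy.le] at h2
  rw [card_filter_erase_lt_of_le hxz.le, card_filter_erase_lt_of_le hyz.le] at h3
  have e1 := card_filter_erase_lt_of_lt hx hxy
  have e2 := card_filter_erase_lt_of_lt hx hxz
  have e3 := card_filter_erase_lt_of_lt hy hyz
  rw [← e1] at h3
  have e4 : ((W.erase y).filter (· < z)).card = ((W.erase x).filter (· < z)).card := by omega
  rw [e4] at h2
  rw [Nat.even_add_one] at h3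
  generalize ((W.erase x).erase y ∈ e) = p at h1 h2
  generalize ((W.erase x).erase z ∈ e) = q at h1 h3
  generalize ((W.erase y).erase z ∈ e) = r at h2 h3
  generalize Even ((W.erase x).filter (· < y)).card = u at h1 h3
  generalize Even ((W.erase x).filter (· < z)).card = v at h1 h2
  generalize Even (W.filter (· < x)).card = w at h2 h3
  by_cases p <;> by_cases q <;> by_cases r <;> simp_all

/-- A `k`-set contains at least `choose k a / k` subsets of size `a`, no two of which
share a facet. -/
theorem exists_disjoint_facets (S : Finset ℕ) (hS : 0 < S.card) (a : ℕ) :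
    ∃ T ⊆ S.powersetCard a, ((S.card.choose a : ℝ) / S.card) ≤ T.card ∧
      ∀ U ∈ T, ∀ V ∈ T, U ≠ V → Disjoint (facets U) (facets V) := by
  set k := S.card with hk
  let h : ℕ → ℕ := fun x => (S.filter (· < x)).card
  have hinj : ∀ x ∈ S, ∀ y ∈ S, x < y → h x < h y := by
    intro x hx y hy hxy
    refine card_lt_card (ssubset_iff_of_subset ?_ |>.2 ⟨x, by simp [hx, hxy], by simp⟩)
    exact monotone_filter_right _ (fun z _ hz => lt_trans hz hxy)
  have hlt : ∀ x ∈ S, h x < k := fun x hx =>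
    card_lt_card (filter_ssubset.2 ⟨x, hx, by simp⟩)
  obtain ⟨r, -, hr⟩ := exists_le_card_fiber_of_nsmul_le_card_of_maps_to
    (s := S.powersetCard a) (t := range k) (f := fun U => (∑ x ∈ U, h x) % k)
    (b := (k.choose a : ℝ) / k) (fun U _ => by simpa using Nat.mod_lt _ hS)
    (by simpa using hS.ne') (by
      have : (k : ℝ) ≠ 0 := by exact_mod_cast hS.ne'
      rw [card_range, card_powersetCard, nsmul_eq_mul, mul_div_cancel₀ _ this])
  refine ⟨_, filter_subset _ _, hr, ?_⟩
  intro U hU V hV hUV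
  rw [mem_filter, mem_powersetCard] at hU hV
  rw [disjoint_left]
  intro F hFU hFV
  obtain ⟨x, hx, rfl⟩ := mem_image.1 hFU
  obtain ⟨y, hy, hxy⟩ := mem_image.1 hFV
  have hsU := add_sum_erase U h hx
  have hsV := add_sum_erase V h hy
  rw [hxy] at hsV
  have hmod : h x ≡ h y [MOD k] := by
    apply Nat.ModEq.add_right_cancel' (∑ z ∈ U.erase x, h z)
    rw [Nat.ModEq, hsU, hsV]
    exact hU.2.trans hV.2.symm
  have hxS := hU.1.1 hx
  have hyS := hV.1.1 hy
  have heq : h x = h y := Nat.ModEq.eq_of_lt_of_lt hmod (hlt x hxS) (hlt y hyS)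
  have : x = y := by
    rcases lt_trichotomy x y with hl | hl | hl
    · exact absurd heq (hinj x hxS y hyS hl).ne
    · exact hl
    · exact absurd heq (hinj y hyS x hxS hl).ne'
  apply hUV
  rw [← insert_erase hx, ← hxy, this, insert_erase hy]

theorem card_not_alternates_le (n a : ℕ) {S : Finset ℕ} (hSn : S ⊆ range n) (hS : 0 < S.card) :
    ∃ m : ℕ, ((S.card.choose a : ℝ) / S.card) ≤ m ∧ ∀ B ⊆ (range n).powerset.powerset,
      (∀ e ∈ B, ∀ U ⊆ S, U.card = a → ¬ Alternates e U) →
      (B.card : ℝ) ≤ (1 - (2 ^ a)⁻¹) ^ m * 2 ^ (range n).powerset.card := by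
  obtain ⟨T, hTS, hT, hdisj⟩ := exists_disjoint_facets S hS a
  refine ⟨T.card, hT, fun B hB hBS => ?_⟩
  have hT' : ∀ U ∈ T, U ⊆ S ∧ U.card = a := fun U hU => mem_powersetCard.1 (hTS hU)
  refine le_trans ?_ (card_filter_inter_ne_le (range n).powerset a facets evenFacets T
    ?_ ?_ ?_ hdisj)
  · exact Nat.cast_le.2 <| card_le_card fun e he => mem_filter.2 ⟨hB he, fun U hU h =>
      hBS e he U (hT' U hU).1 (hT' U hU).2 (alternates_of_inter_facets h)⟩
  · intro U hU F hF
    obtain ⟨x, -, rfl⟩ := mem_image.1 hF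
    exact mem_powerset.2 ((erase_subset _ _).trans ((hT' U hU).1.trans hSn))
  · exact fun U hU => card_image_le.trans (hT' U hU).2.le
  · exact fun U _ => image_subset_image (filter_subset _ _)

/-- The union bound over all `k`-subsets. -/
theorem exists_alternates_of_pow_mul_lt {n a k : ℕ} (hk : 0 < k)
    (h : ∀ m : ℕ, ((k.choose a : ℝ) / k) ≤ m → (n : ℝ) ^ k * (1 - (2 ^ a)⁻¹) ^ m < 1) :
    ∃ e : Finset (Finset ℕ), ∀ S ⊆ range n, S.card = k →
      ∃ U ⊆ S, U.card = a ∧ Alternates e U := by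
  classical
  by_contra! hcon
  let X := (range n).powerset
  let q : ℝ := ((1 - (2 ^ a)⁻¹) ^ ⌈(k.choose a : ℝ) / k⌉₊)
  let B : Finset ℕ → Finset (Finset (Finset ℕ)) := fun S =>
    X.powerset.filter fun e => ∀ U ⊆ S, U.card = a → ¬ Alternates e U
  have hq : (0 : ℝ) ≤ 1 - (2 ^ a)⁻¹ :=
    sub_nonneg.2 (inv_le_one_of_one_le₀ (one_le_pow₀ (by norm_num)))
  have hq1 : (1 : ℝ) - (2 ^ a)⁻¹ ≤ 1 := sub_le_self _ (by positivity)
  have hcover : X.powerset ⊆ ((range n).powersetCard k).biUnion B := by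
    intro e he
    obtain ⟨S, hS, hSk, hSU⟩ := hcon e
    exact mem_biUnion.2 ⟨S, mem_powersetCard.2 ⟨hS, hSk⟩, mem_filter.2 ⟨he, hSU⟩⟩
  have hB : ∀ S ∈ (range n).powersetCard k, ((B S).card : ℝ) ≤ q * 2 ^ X.card := by
    intro S hS
    obtain ⟨hSn, hSk⟩ := mem_powersetCard.1 hS
    obtain ⟨m, hm, hmB⟩ := card_not_alternates_le n a hSn (hSk ▸ hk)
    refine (hmB (B S) (filter_subset _ _) (fun e he => (mem_filter.1 he).2)).trans ?_
    rw [hSk] at hm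
    exact mul_le_mul_of_nonneg_right
      (pow_le_pow_of_le_one hq hq1 (Nat.ceil_le.2 hm)) (by positivity)
  have htotal : (2 : ℝ) ^ X.card ≤ n.choose k * (q * 2 ^ X.card) := by
    calc (2 : ℝ) ^ X.card = (X.powerset.card : ℝ) := by rw [card_powerset X]; norm_cast
      _ ≤ ((((range n).powersetCard k).biUnion B).card : ℝ) := by
        exact_mod_cast card_le_card hcover
      _ ≤ ∑ S ∈ (range n).powersetCard k, ((B S).card : ℝ) := by
        exact_mod_cast card_biUnion_le
      _ ≤ ((range n).powersetCard k).card • (q * 2 ^ X.card) := sum_le_card_nsmul _ _ _ hB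
      _ = n.choose k * (q * 2 ^ X.card) := by
        rw [card_powersetCard, card_range, nsmul_eq_mul]
  have hchoose : (n.choose k : ℝ) ≤ (n : ℝ) ^ k := by exact_mod_cast Nat.choose_le_pow n k
  have hlt := h _ (Nat.le_ceil _)
  have hq0 : 0 ≤ q := pow_nonneg hq _
  have h2X : (0 : ℝ) < 2 ^ X.card := by positivity
  have hle : (n.choose k : ℝ) * q ≤ (n : ℝ) ^ k * q := mul_le_mul_of_nonneg_right hchoose hq0
  have hlt' : (n.choose k : ℝ) * q < 1 := hle.trans_lt hlt
  nlinarith [mul_lt_mul_of_pos_right hlt' h2X]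

theorem pow_succ_div_le_choose_div {d k : ℕ} (hk : 2 * (d + 2) ≤ k) :
    (k : ℝ) ^ (d + 1) / (2 ^ (d + 2) * (d + 2).factorial) ≤ (k.choose (d + 2) : ℝ) / k := by
  have hk0 : (0 : ℝ) < k := by exact_mod_cast (by omega : 0 < k)
  have h1 : (((k + 1 - (d + 2) : ℕ) : ℝ)) ^ (d + 2) ≤ (d + 2).factorial * k.choose (d + 2) := by
    exact (div_le_iff₀' (by positivity)).1 (Nat.pow_le_choose (d + 2) k)
  have h2 : (k : ℝ) / 2 ≤ ((k + 1 - (d + 2) : ℕ) : ℝ) := by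
    rw [div_le_iff₀ (by norm_num)]
    exact_mod_cast (by omega : k ≤ (k + 1 - (d + 2)) * 2)
  have h3 := (pow_le_pow_left₀ (by positivity) h2 (d + 2)).trans h1
  rw [div_pow, div_le_iff₀ (by positivity)] at h3
  rw [div_le_div_iff₀ (by positivity) hk0]
  calc (k : ℝ) ^ (d + 1) * k = k ^ (d + 2) := (pow_succ _ _).symm
    _ ≤ _ := h3
    _ = _ := by ring

theorem pow_mul_one_sub_pow_lt_one {d k m : ℕ} {c : ℝ}
    (hc : c = (2 * (2 ^ (d + 2) * (2 ^ (d + 2) * ((d + 2).factorial : ℝ))))⁻¹)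
    (hk : 2 * (d + 2) ≤ k) (hm : (k.choose (d + 2) : ℝ) / k ≤ m) :
    ((⌊(2 : ℝ) ^ (c * (k : ℝ) ^ d)⌋₊ : ℕ) : ℝ) ^ k * (1 - (2 ^ (d + 2))⁻¹) ^ m < 1 := by
  have hk0 : (0 : ℝ) < k := by exact_mod_cast (by omega : 0 < k)
  have hc0 : 0 < c := by rw [hc]; positivity
  have hn : ((⌊(2 : ℝ) ^ (c * (k : ℝ) ^ d)⌋₊ : ℕ) : ℝ) ≤ Real.exp (c * (k : ℝ) ^ d) := by
    refine (Nat.floor_le (by positivity)).trans ?_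
    rw [← Real.exp_one_rpow]
    exact Real.rpow_le_rpow (by norm_num) (by linarith [Real.add_one_le_exp (1 : ℝ)])
      (by positivity)
  have hq : (0 : ℝ) ≤ 1 - (2 ^ (d + 2))⁻¹ :=
    sub_nonneg.2 (inv_le_one_of_one_le₀ (one_le_pow₀ (by norm_num)))
  have hq' : 1 - ((2 : ℝ) ^ (d + 2))⁻¹ ≤ Real.exp (-((2 : ℝ) ^ (d + 2))⁻¹) :=
    Real.one_sub_le_exp_neg _
  have hm' := (pow_succ_div_le_choose_div hk).trans hm
  calc _ ≤ Real.exp (c * (k : ℝ) ^ d) ^ k * Real.exp (-((2 : ℝ) ^ (d + 2))⁻¹) ^ m := by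
        gcongr
    _ = Real.exp (c * (k : ℝ) ^ (d + 1) - m * ((2 : ℝ) ^ (d + 2))⁻¹) := by
        rw [← Real.exp_nat_mul, ← Real.exp_nat_mul, ← Real.exp_add]
        congr 1
        ring
    _ < 1 := by
        rw [Real.exp_lt_one_iff, sub_neg]
        refine lt_of_lt_of_le ?_ (mul_le_mul_of_nonneg_right hm' (by positivity))
        have : (k : ℝ) ^ (d + 1) / (2 ^ (d + 2) * (d + 2).factorial) * ((2 : ℝ) ^ (d + 2))⁻¹ =
            2 * (c * (k : ℝ) ^ (d + 1)) := by
          rw [hc]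
          field_simp
        rw [this]
        have : 0 < c * (k : ℝ) ^ (d + 1) := by positivity
        linarith

/-- `R_{d+2}(d+3, k) > 2^{c_d·k^d}`: with `n = ⌊2^{c·k^d}⌋` there is a
red/blue (`true`/`false`) coloring of the `(d+2)`-subsets of `[n]` with no all-red
`(d+3)`-set and no all-blue `k`-set. -/
theorem ramsey_lower_bound (d : ℕ) (hd : 1 ≤ d) :
    ∃ c : ℝ, 0 < c ∧ ∃ K : ℕ, ∀ k : ℕ, K ≤ k →
      ∃ χ : Finset ℕ → Bool,
        (∀ W ⊆ Finset.range ⌊(2 : ℝ) ^ (c * (k : ℝ) ^ d)⌋₊, W.card = d + 3 →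
          ∃ U ⊆ W, U.card = d + 2 ∧ χ U = false) ∧
        (∀ S ⊆ Finset.range ⌊(2 : ℝ) ^ (c * (k : ℝ) ^ d)⌋₊, S.card = k →
          ∃ U ⊆ S, U.card = d + 2 ∧ χ U = true) := by
  classical
  refine ⟨(2 * (2 ^ (d + 2) * (2 ^ (d + 2) * ((d + 2).factorial : ℝ))))⁻¹, by positivity,
    2 * (d + 2), fun k hk => ?_⟩
  obtain ⟨e, he⟩ := exists_alternates_of_pow_mul_lt (a := d + 2) (by omega)
    (fun m hm => pow_mul_one_sub_pow_lt_one rfl hk hm)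
  refine ⟨fun U => decide (Alternates e U), fun W _ hW => ?_, fun S hS hSk => ?_⟩
  · obtain ⟨x, hx, hxe⟩ := exists_erase_not_alternates e (W := W) (by omega)
    exact ⟨W.erase x, erase_subset _ _, by rw [card_erase_of_mem hx]; omega,
      decide_eq_false hxe⟩
  · obtain ⟨U, hU, hUc, hUe⟩ := he S hS hSk
    exact ⟨U, hU, hUc, decide_eq_true hUe⟩
end

section
/- For every integer d ≥ 1 there exist a constant c > 0 and N such that for all n ≥ N, the number of d-tournaments on vertex set [n] that contain no (d+2)-cycle is at most 2^{binom(n,d+1) − c·n^{d+1}}. -/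
open Finset

/-- The sign of `τ` in a set obtained from `τ` by adding one point. -/
lemma relSign_insert_s11 {τ : Finset ℕ} {a : ℕ} (ha : a ∉ τ) :
    relSign τ (insert a τ) = (-1) ^ (#τ - #{y ∈ τ | y < a}) := by
  have hd : insert a τ \ τ = {a} := by
    ext y
    simp only [mem_sdiff, mem_insert, mem_singleton]
    grind
  rw [relSign, if_pos ⟨subset_insert _ _, (card_insert_of_notMem ha).symm⟩, hd, sum_singleton,
    card_insert_of_notMem ha, filter_insert, if_neg (lt_irrefl a), Nat.add_sub_cancel]

lemma relSign_eq_zero {τ σ : Finset ℕ} (h : ¬(τ ⊆ σ ∧ #τ + 1 = #σ)) : relSign τ σ = 0 :=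
  if_neg h

/-- A face of codimension one is obtained by deleting a point. -/
lemma exists_eq_insert_of_subset {τ σ : Finset ℕ} (h : τ ⊆ σ) (hc : #τ + 1 = #σ) :
    ∃ a ∉ τ, σ = insert a τ := by
  obtain ⟨a, ha⟩ := card_eq_one.1 (show #(σ \ τ) = 1 by rw [card_sdiff_of_subset h]; omega)
  refine ⟨a, (mem_sdiff.1 (ha ▸ mem_singleton_self a)).2, ?_⟩
  rw [← sdiff_union_of_subset h, ha, insert_eq]

lemma relSign_eq_one_or {τ σ : Finset ℕ} (h : τ ⊆ σ) (hc : #τ + 1 = #σ) :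
    relSign τ σ = 1 ∨ relSign τ σ = -1 := by
  obtain ⟨a, ha, rfl⟩ := exists_eq_insert_of_subset h hc
  rw [relSign_insert_s11 ha]
  exact neg_one_pow_eq_or ℤ _

/-- The two paths from `τ` to `τ ∪ {a, b}` have opposite signs. -/
lemma relSign_mul_relSign_add {τ : Finset ℕ} {a b : ℕ} (ha : a ∉ τ) (hb : b ∉ τ) (hab : a < b) :
    relSign (insert a τ) (insert b (insert a τ)) * relSign τ (insert a τ) +
      relSign (insert b τ) (insert b (insert a τ)) * relSign τ (insert b τ) = 0 := by
  have hba : b ∉ insert a τ := by simp [hb, hab.ne']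
  have hab' : a ∉ insert b τ := by simp [ha, hab.ne]
  have hle : #{y ∈ τ | y < a} ≤ #τ := card_filter_le _ _
  rw [relSign_insert_s11 hba, relSign_insert_s11 ha, insert_comm b a τ, relSign_insert_s11 hab',
    relSign_insert_s11 hb, card_insert_of_notMem ha, card_insert_of_notMem hb, filter_insert,
    filter_insert, if_pos hab, if_neg hab.not_gt, card_insert_of_notMem (by simp [ha]),
    Nat.add_sub_add_right, Nat.sub_add_comm hle, pow_succ]
  ring

/-- The boundary of a boundary vanishes. -/
lemma sum_relSign_mul_relSign {d : ℕ} {U : Finset ℕ} (hU : #U = d + 2) (τ : Finset ℕ) :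
    ∑ F ∈ U.powersetCard (d + 1), relSign F U * relSign τ F = 0 := by
  by_cases h : τ ⊆ U ∧ #τ = d
  · obtain ⟨hτ, hc⟩ := h
    obtain ⟨a, b, hlt, hab⟩ : ∃ a b, a < b ∧ U \ τ = {a, b} := by
      obtain ⟨a, b, hne, hab⟩ :=
        card_eq_two.1 (show #(U \ τ) = 2 by rw [card_sdiff_of_subset hτ]; omega)
      rcases hne.lt_or_gt with h | h
      · exact ⟨a, b, h, hab⟩
      · exact ⟨b, a, h, by rw [hab, pair_comm]⟩
    have ha : a ∉ τ := (mem_sdiff.1 (hab ▸ mem_insert_self a {b})).2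
    have hb : b ∉ τ := (mem_sdiff.1 (hab ▸ mem_insert_of_mem (mem_singleton_self b))).2
    have hUeq : U = insert b (insert a τ) := by
      rw [← sdiff_union_of_subset hτ, hab]
      ext y
      simp only [mem_union, mem_insert, mem_singleton]
      tauto
    have hne : insert a τ ≠ insert b τ := fun h => by
      have := h ▸ mem_insert_self a τ
      simp [ha, hlt.ne] at this
    rw [← sum_subset (s₁ := {insert a τ, insert b τ}), sum_pair hne, hUeq,
      relSign_mul_relSign_add ha hb hlt]
    · intro F hF
      rw [mem_powersetCard, hUeq]
      rcases mem_insert.1 hF with rfl | hF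
      · exact ⟨subset_insert _ _, by rw [card_insert_of_notMem ha, hc]⟩
      · rw [mem_singleton.1 hF]
        exact ⟨insert_subset_insert _ (subset_insert _ _), by rw [card_insert_of_notMem hb, hc]⟩
    · intro F hF hF'
      by_cases hτF : τ ⊆ F ∧ #τ + 1 = #F
      · obtain ⟨x, hx, rfl⟩ := exists_eq_insert_of_subset hτF.1 hτF.2
        have hxU : x ∈ U \ τ :=
          mem_sdiff.2 ⟨(mem_powersetCard.1 hF).1 (mem_insert_self x τ), hx⟩
        rw [hab, mem_insert, mem_singleton] at hxU
        rcases hxU with rfl | rfl <;> simp at hF'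
      · rw [relSign_eq_zero hτF, mul_zero]
  · refine sum_eq_zero fun F hF => ?_
    rw [mem_powersetCard] at hF
    rw [relSign_eq_zero (τ := τ) fun h' => h ⟨h'.1.trans hF.1, by omega⟩, mul_zero]

/-- Signs agreeing with the boundary of `U` make `U` a `(d+2)`-cycle. -/
lemma isDCycle_of_eq_relSign {V U : Finset ℕ} {d : ℕ} {ε : Finset ℕ → ℤ} (hUV : U ⊆ V)
    (hU : #U = d + 2) (h : ∀ F ∈ U.powersetCard (d + 1), ε F = relSign F U) :
    IsDCycle V d ε U := by
  refine ⟨hUV, hU, powersetCard_nonempty.2 (by omega), fun F hF => ?_, fun _ => 1,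
    fun _ _ => one_pos, fun τ => ?_⟩
  · rw [mem_powersetCard] at hF
    exact ⟨hF.1.trans hUV, hF.2⟩
  · rw [← Int.cast_zero, ← sum_relSign_mul_relSign hU τ, Int.cast_sum]
    refine sum_congr rfl fun F hF => ?_
    rw [h F hF, one_mul, Int.cast_mul]

/-- Subsets of `X` avoiding one prescribed trace on each of a family of disjoint `k`-sets. -/
lemma card_avoiding_traces_mul_le {α ι : Type*} [DecidableEq α] [DecidableEq ι] {k : ℕ}
    {A B : ι → Finset α} (P : Finset ι) (X : Finset α)
    (hAX : ∀ i ∈ P, A i ⊆ X) (hBA : ∀ i ∈ P, B i ⊆ A i) (hk : ∀ i ∈ P, #(A i) = k)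
    (hdisj : (P : Set ι).PairwiseDisjoint A) :
    #{S ∈ X.powerset | ∀ i ∈ P, S ∩ A i ≠ B i} * (2 ^ k) ^ #P ≤ 2 ^ #X * (2 ^ k - 1) ^ #P := by
  induction P using Finset.induction_on generalizing X with
  | empty => simp
  | insert i P hi ih =>
    have hiA := hAX i (mem_insert_self i P)
    have hd : ∀ j ∈ P, Disjoint (A j) (A i) := fun j hj =>
      hdisj (mem_insert_of_mem hj) (mem_insert_self i P) (by rintro rfl; exact hi hj)
    have hrec := ih (X \ A i)
      (fun j hj => subset_sdiff.2 ⟨hAX j (mem_insert_of_mem hj), hd j hj⟩)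
      (fun j hj => hBA j (mem_insert_of_mem hj)) (fun j hj => hk j (mem_insert_of_mem hj))
      (hdisj.subset (by simp))
    have hX : #(X \ A i) + k = #X := by
      rw [← hk i (mem_insert_self i P), card_sdiff_add_card_eq_card hiA]
    have hle : #{S ∈ X.powerset | ∀ j ∈ insert i P, S ∩ A j ≠ B j} ≤
        (2 ^ k - 1) * #{S ∈ (X \ A i).powerset | ∀ j ∈ P, S ∩ A j ≠ B j} := by
      rw [← hk i (mem_insert_self i P), ← card_powerset,
        ← card_erase_of_mem (mem_powerset.2 (hBA i (mem_insert_self i P))), ← card_product]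
      refine card_le_card_of_injOn (fun S => (S ∩ A i, S \ A i)) (fun S hS => ?_)
        (fun S _ T _ hST => ?_)
      · obtain ⟨hSX, hS⟩ := mem_filter.1 hS
        refine mem_product.2 ⟨mem_erase.2 ⟨hS i (mem_insert_self i P), ?_⟩, mem_filter.2 ⟨?_, ?_⟩⟩
        · exact mem_powerset.2 inter_subset_right
        · exact mem_powerset.2 (sdiff_subset_sdiff (mem_powerset.1 hSX) subset_rfl)
        · intro j hj
          have : S \ A i ∩ A j = S ∩ A j := by
            rw [sdiff_inter_right_comm, sdiff_eq_self_of_disjoint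
              ((hd j hj).mono_left inter_subset_right)]
          exact this ▸ hS j (mem_insert_of_mem hj)
      · obtain ⟨h₁, h₂⟩ := Prod.mk.inj hST
        rw [← sdiff_union_inter S (A i), ← sdiff_union_inter T (A i), h₁, h₂]
    rw [card_insert_of_notMem hi]
    calc _ ≤ (2 ^ k - 1) * #{S ∈ (X \ A i).powerset | ∀ j ∈ P, S ∩ A j ≠ B j} *
          (2 ^ k) ^ (#P + 1) := Nat.mul_le_mul_right _ hle
      _ = (2 ^ k - 1) * 2 ^ k * (#{S ∈ (X \ A i).powerset | ∀ j ∈ P, S ∩ A j ≠ B j} *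
          (2 ^ k) ^ #P) := by ring
      _ ≤ (2 ^ k - 1) * 2 ^ k * (2 ^ #(X \ A i) * (2 ^ k - 1) ^ #P) := Nat.mul_le_mul_left _ hrec
      _ = 2 ^ #X * (2 ^ k - 1) ^ (#P + 1) := by rw [← hX]; ring

/-- Two sets with the same sum modulo `n` share no face of codimension one. -/
lemma disjoint_powersetCard_of_sum_mod_eq {n k : ℕ} {U W : Finset ℕ} (hU : U ⊆ range n)
    (hW : W ⊆ range n) (hUk : #U = k + 1) (hWk : #W = k + 1)
    (hmod : (∑ x ∈ U, x) % n = (∑ x ∈ W, x) % n) (hne : U ≠ W) :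
    Disjoint (U.powersetCard k) (W.powersetCard k) := by
  rw [disjoint_left]
  intro F hFU hFW
  rw [mem_powersetCard] at hFU hFW
  obtain ⟨a, ha, rfl⟩ := exists_eq_insert_of_subset hFU.1 (by omega)
  obtain ⟨b, hb, rfl⟩ := exists_eq_insert_of_subset hFW.1 (by omega)
  rw [sum_insert ha, sum_insert hb] at hmod
  have han := mem_range.1 (hU (mem_insert_self a F))
  have hbn := mem_range.1 (hW (mem_insert_self b F))
  have : a % n = b % n := Nat.ModEq.add_right_cancel' _ hmod
  rw [Nat.mod_eq_of_lt han, Nat.mod_eq_of_lt hbn] at this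
  exact hne (by rw [this])

/-- A partial Steiner system: many `(k+1)`-sets with pairwise disjoint families of `k`-subsets. -/
lemma exists_packing (n k : ℕ) (hn : 0 < n) :
    ∃ P ⊆ (range n).powersetCard (k + 1),
      (P : Set (Finset ℕ)).PairwiseDisjoint (powersetCard k) ∧
        (n.choose (k + 1) : ℝ) / n ≤ #P := by
  obtain ⟨r, -, hr⟩ := exists_le_card_fiber_of_nsmul_le_card_of_maps_to
    (s := (range n).powersetCard (k + 1)) (t := range n) (f := fun U => (∑ x ∈ U, x) % n)
    (b := (n.choose (k + 1) : ℝ) / n) (fun U _ => mem_range.2 (Nat.mod_lt _ hn))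
    (nonempty_range_iff.2 hn.ne') (by
      rw [card_powersetCard, card_range, nsmul_eq_mul, mul_div_cancel₀]
      exact_mod_cast hn.ne')
  refine ⟨_, filter_subset _ _, fun U hU W hW hne => ?_, hr⟩
  simp only [coe_filter, mem_powersetCard, Set.mem_ofPred_eq] at hU hW
  exact disjoint_powersetCard_of_sum_mod_eq hU.1.1 hW.1.1 hU.1.2 hW.1.2
    (hU.2.trans hW.2.symm) hne

/-- A packing of `(d+2)`-sets bounds the number of tournaments without `(d+2)`-cycles. -/
lemma card_no_dCycle_mul_le {n d : ℕ} {P : Finset (Finset ℕ)}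
    (hP : P ⊆ (range n).powersetCard (d + 2))
    (hdisj : (P : Set (Finset ℕ)).PairwiseDisjoint (powersetCard (d + 1))) :
    Nat.card {ε : Finset ℕ → ℤ // IsTournament (range n) d ε ∧
        ∀ U : Finset ℕ, ¬ IsDCycle (range n) d ε U} * (2 ^ (d + 2)) ^ #P ≤
      2 ^ n.choose (d + 1) * (2 ^ (d + 2) - 1) ^ #P := by
  set X := (range n).powersetCard (d + 1) with hX
  have hcard := card_avoiding_traces_mul_le (k := d + 2) (A := powersetCard (d + 1))
    (B := fun U => {F ∈ U.powersetCard (d + 1) | relSign F U = 1}) P X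
    (fun U hU => powersetCard_mono (mem_powersetCard.1 (hP hU)).1)
    (fun U _ => filter_subset _ _)
    (fun U hU => by
      rw [card_powersetCard, (mem_powersetCard.1 (hP hU)).2]
      exact Nat.choose_succ_self_right _)
    hdisj
  rw [hX, card_powersetCard, card_range, ← hX] at hcard
  refine (Nat.mul_le_mul_right _ ?_).trans hcard
  rw [← Nat.card_eq_finsetCard]
  refine Nat.card_le_card_of_injective (fun ε => ⟨{F ∈ X | ε.1 F = 1}, mem_filter.2
    ⟨mem_powerset.2 (filter_subset _ _), fun U hU hεU => ?_⟩⟩) fun ε η hεη => ?_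
  · obtain ⟨hUn, hUc⟩ := mem_powersetCard.1 (hP hU)
    refine ε.2.2 U (isDCycle_of_eq_relSign hUn hUc fun F hF => ?_)
    obtain ⟨hFU, hFc⟩ := mem_powersetCard.1 hF
    have hFX : F ∈ X := powersetCard_mono hUn hF
    have hiff : ε.1 F = 1 ↔ relSign F U = 1 := by
      simpa [hF, hFX] using congrArg (F ∈ ·) hεU
    have hε := (ε.2.1 F).1 ⟨hFU.trans hUn, hFc⟩
    have hr := relSign_eq_one_or hFU (by omega)
    omega
  · refine Subtype.ext (funext fun F => ?_)
    by_cases hF : F ⊆ range n ∧ #F = d + 1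
    · have hFX : F ∈ X := mem_powersetCard.2 hF
      have hiff : ε.1 F = 1 ↔ η.1 F = 1 := by
        simpa [hFX] using congrArg (F ∈ ·) (Subtype.ext_iff.1 hεη)
      have hε := (ε.2.1 F).1 hF
      have hη := (η.2.1 F).1 hF
      omega
    · rw [(ε.2.1 F).2 hF, (η.2.1 F).2 hF]

/-- For large `n`, binomial coefficients have order `n ^ k`. -/
lemma div_pow_le_choose {n k : ℕ} (hn : 2 * k ≤ n) :
    (n : ℝ) ^ k / (2 ^ k * k.factorial) ≤ n.choose k := by
  rw [div_le_iff₀ (by positivity)]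
  have hdesc : (n + 1 - k) ^ k ≤ k.factorial * n.choose k :=
    (Nat.pow_sub_le_descFactorial n k).trans_eq (Nat.descFactorial_eq_factorial_mul_choose n k)
  have hpow : n ^ k ≤ n.choose k * (2 ^ k * k.factorial) := by
    calc n ^ k ≤ (2 * (n + 1 - k)) ^ k := Nat.pow_le_pow_left (by omega) k
      _ = 2 ^ k * (n + 1 - k) ^ k := mul_pow _ _ _
      _ ≤ 2 ^ k * (k.factorial * n.choose k) := Nat.mul_le_mul_left _ hdesc
      _ = _ := by ring
  exact_mod_cast hpow

lemma one_sub_le_two_rpow_neg {x : ℝ} (hx : 0 ≤ x) : 1 - x ≤ (2 : ℝ) ^ (-x) := by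
  rw [Real.rpow_def_of_pos two_pos]
  have := Real.add_one_le_exp (Real.log 2 * -x)
  nlinarith [Real.log_two_lt_d9]

/-- the number of `d`-tournaments on `[n]` with no `(d+2)`-cycle is at
most `2^{C(n,d+1) - c·n^{d+1}}` for all large `n`. -/
theorem count_no_small_cycle_upper (d : ℕ) (hd : 1 ≤ d) :
    ∃ c : ℝ, 0 < c ∧ ∃ N : ℕ, ∀ n : ℕ, N ≤ n →
      (Nat.card {ε : Finset ℕ → ℤ // IsTournament (Finset.range n) d ε ∧
          ∀ U : Finset ℕ, ¬ IsDCycle (Finset.range n) d ε U} : ℝ) ≤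
        (2 : ℝ) ^ ((n.choose (d + 1) : ℝ) - c * (n : ℝ) ^ (d + 1)) := by
  set k := d + 2 with hk
  refine ⟨1 / (2 ^ k * (2 ^ k * k.factorial)), by positivity, 2 * k, fun n hn => ?_⟩
  have hn0 : 0 < n := by omega
  have hnR : (0 : ℝ) < n := by exact_mod_cast hn0
  obtain ⟨P, hP, hdisj, hcard⟩ := exists_packing n (d + 1) hn0
  have hmain := card_no_dCycle_mul_le hP hdisj
  set K := Nat.card {ε : Finset ℕ → ℤ // IsTournament (Finset.range n) d ε ∧
    ∀ U : Finset ℕ, ¬ IsDCycle (Finset.range n) d ε U}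
  have hsize : (n : ℝ) ^ (d + 1) / (2 ^ k * k.factorial) ≤ #P := by
    refine le_trans ?_ hcard
    rw [le_div_iff₀ hnR]
    refine le_trans (le_of_eq ?_) (div_pow_le_choose hn)
    rw [hk]
    ring
  have hmainR : (K : ℝ) * (2 ^ k) ^ #P ≤ 2 ^ n.choose (d + 1) * (2 ^ k - 1) ^ #P := by
    have := (Nat.cast_le (α := ℝ)).2 hmain
    rwa [Nat.cast_mul, Nat.cast_mul, Nat.cast_pow, Nat.cast_pow, Nat.cast_pow, Nat.cast_pow,
      Nat.cast_sub Nat.one_le_two_pow, Nat.cast_pow, Nat.cast_ofNat, Nat.cast_one] at this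
  have hx : (1 : ℝ) / 2 ^ k ≤ 1 := by
    rw [div_le_one (by positivity)]
    exact one_le_pow₀ one_le_two
  calc (K : ℝ) ≤ 2 ^ n.choose (d + 1) * (2 ^ k - 1) ^ #P / (2 ^ k) ^ #P :=
        (le_div_iff₀ (by positivity)).2 hmainR
    _ = 2 ^ n.choose (d + 1) * (1 - 1 / 2 ^ k) ^ #P := by
        rw [mul_div_assoc, ← div_pow, sub_div, div_self (by positivity)]
    _ ≤ 2 ^ n.choose (d + 1) * ((2 : ℝ) ^ (-(1 / 2 ^ k : ℝ))) ^ #P := by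
        gcongr
        exact one_sub_le_two_rpow_neg (by positivity)
    _ = (2 : ℝ) ^ ((n.choose (d + 1) : ℝ) - 1 / 2 ^ k * #P) := by
        rw [← Real.rpow_natCast, ← Real.rpow_natCast, ← Real.rpow_mul two_pos.le,
          ← Real.rpow_add two_pos, neg_mul, sub_eq_add_neg]
    _ ≤ _ := by
        refine Real.rpow_le_rpow_of_exponent_le one_le_two (sub_le_sub_left ?_ _)
        calc _ = 1 / 2 ^ k * ((n : ℝ) ^ (d + 1) / (2 ^ k * k.factorial)) := by
              rw [div_mul_div_comm, div_mul_eq_mul_div]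
          _ ≤ _ := by gcongr
end
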